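/- Let K ∈ ℕ and let λ > 1/2 be a fixed constant. Let (G_n)_{n∈ℕ} be a sequence of finite graphs with G_n ∈ H(K) for every n and δ(G_n) → ∞ as n → ∞, and let p = p(n) ∈ [0,1] satisfy p(n) ≥ 1/2 − (1/2)·√(log Δ(G_n)/Δ(G_n)) + λ·log log Δ(G_n)/√(Δ(G_n)·log Δ(G_n)) for all n. Then Φ(p(n), G_n) → 1 as n → ∞. -/

import Mathlib

open SimpleGraph Filter

namespace MBP

/-- Degree of a vertex, via the cardinality of its neighbourhood. -/
noncomputable def deg {V : Type} (G : SimpleGraph V) (x : V) : ℕ :=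
  (G.neighborSet x).ncard

/-- Minimum degree. -/
noncomputable def minDeg {V : Type} (G : SimpleGraph V) : ℕ :=
  sInf (Set.range (deg G))

/-- Maximum degree. -/
noncomputable def maxDeg {V : Type} (G : SimpleGraph V) : ℕ :=
  sSup (Set.range (deg G))

/-- Ball of radius `ℓ` around `x`. -/
def ball {V : Type} (G : SimpleGraph V) (x : V) (ℓ : ℕ) : Set V :=
  {y | G.edist x y ≤ ℓ}

/-- Sphere of radius `ℓ` around `x` (for `ℓ ≥ 1` this is `B(x,ℓ) \ B(x,ℓ-1)`). -/
def sphere {V : Type} (G : SimpleGraph V) (x : V) (ℓ : ℕ) : Set V :=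
  {y | G.edist x y = ℓ}

/-- (P1) locally K-almost regular. -/
def P1 (K : ℕ) {V : Type} (G : SimpleGraph V) : Prop :=
  ∀ (x : V) (ℓ : ℕ), 1 ≤ ℓ → ∀ y ∈ sphere G x ℓ,
    |(deg G x : ℤ) - (deg G y : ℤ)| ≤ (K : ℤ) * ℓ

/-- (P2) K-bounded backwards expansion. -/
def P2 (K : ℕ) {V : Type} (G : SimpleGraph V) : Prop :=
  ∀ (x : V) (ℓ : ℕ), 1 ≤ ℓ → ∀ y ∈ sphere G x ℓ,
    (G.neighborSet y ∩ ball G x ℓ).ncard ≤ K * ℓ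

/-- `D` witnesses property (P3) (typical local structure and K-separation) at vertex `x`. -/
def P3At (K : ℕ) {V : Type} (G : SimpleGraph V) (x : V) (D : Set V) : Prop :=
  x ∉ D ∧ ∀ (ℓ : ℕ), 1 ≤ ℓ →
    ((D ∩ sphere G x ℓ).ncard ≤ K ^ (ℓ - 1) * (deg G x) ^ (ℓ - 1)) ∧
    (∀ y ∈ sphere G x ℓ \ D, (D ∩ G.neighborSet y).ncard ≤ K * ℓ) ∧
    (∀ y ∈ sphere G x ℓ \ D, ∀ z ∈ sphere G x ℓ \ D, y ≠ z →
      (G.neighborSet y ∩ G.neighborSet z ∩ (sphere G x (ℓ + 1) \ D)).ncard ≤ 1) ∧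
    (∀ y ∈ sphere G x ℓ \ D,
      (ball G y (2 * ℓ - 1) ∩ (sphere G x ℓ \ D)).ncard ≤ ℓ * K ^ (ℓ - 1) * (deg G x) ^ (ℓ - 1))

/-- (P3) typical local structure and K-separation. -/
def P3 (K : ℕ) {V : Type} (G : SimpleGraph V) : Prop :=
  ∀ x : V, ∃ D : Set V, P3At K G x D

/-- (P5) exponential order. -/
def P5 (K : ℕ) {V : Type} (G : SimpleGraph V) : Prop :=
  (Nat.card V : ℝ) ≤ Real.exp (K * minDeg G)

/-- (P4) K-projection, relative to a membership predicate `mem` for the projected subgraphs. -/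
def P4With (K : ℕ) {V : Type} (G : SimpleGraph V) (mem : G.Subgraph → Prop) : Prop :=
  ∀ (x : V) (ℓ : ℕ), 1 ≤ ℓ → ∀ y ∈ sphere G x ℓ,
    ∃ H : G.Subgraph, y ∈ H.verts ∧ mem H ∧
      H.verts ∩ ball G x (ℓ - 1) = ∅ ∧
      ∀ w : H.verts, |(deg H.coe w : ℤ) - (deg G (w : V) : ℤ)| ≤ (K : ℤ) * ℓ

/-- Membership in the class H(K) with recursion fuel `n`. -/
def HAux (K : ℕ) : ℕ → (V : Type) → SimpleGraph V → Prop
  | 0, V, _ => Nat.card V = 1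
  | n + 1, V, G =>
      Nat.card V = 1 ∨
        (P1 K G ∧ P2 K G ∧ P3 K G ∧ P4With K G (fun H => HAux K n H.verts H.coe) ∧ P5 K G)

/-- The class `H(K)` of geometric graphs: least class containing the one-vertex graph and
closed under properties (P1)–(P5), where the projections of (P4) again lie in the class. -/
def InH (K : ℕ) {V : Type} (G : SimpleGraph V) : Prop :=
  ∃ n, HAux K n V G

/-- One round of majority bootstrap percolation: a vertex `v` becomes infected if at least
`d(v)/2` of its neighbours are infected. -/
def bootStep {V : Type} (G : SimpleGraph V) (A : Set V) : Set V :=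
  A ∪ {v | (deg G v : ℝ) / 2 ≤ ((G.neighborSet v ∩ A).ncard : ℝ)}

/-- The majority bootstrap percolation process. -/
def bootIter {V : Type} (G : SimpleGraph V) (A0 : Set V) : ℕ → Set V
  | 0 => A0
  | n + 1 => bootStep G (bootIter G A0 n)

/-- `A0` percolates if eventually every vertex is infected. -/
def Percolates {V : Type} (G : SimpleGraph V) (A0 : Set V) : Prop :=
  (⋃ i, bootIter G A0 i) = Set.univ

/-- Weight of a subset `A` under the `p`-random measure. -/
noncomputable def weight {V : Type} (p : ℝ) (A : Set V) : ℝ :=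
  p ^ A.ncard * (1 - p) ^ (Aᶜ).ncard

/-- Probability that a `p`-random subset of `V` satisfies the event `E`. -/
noncomputable def prob {V : Type} (p : ℝ) (E : Set V → Prop) : ℝ :=
  ∑ᶠ A ∈ {A : Set V | E A}, weight p A

/-- Probability that a `p`-random initial set percolates. -/
noncomputable def Phi {V : Type} (p : ℝ) (G : SimpleGraph V) : ℝ :=
  prob p (fun A0 => Percolates G A0)

/-- One round of the `m`-shifted bootstrap process (threshold `d(v)/2 + m`). -/
def bootStepM {V : Type} (G : SimpleGraph V) (m : ℕ) (A : Set V) : Set V :=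
  A ∪ {v | (deg G v : ℝ) / 2 + m ≤ ((G.neighborSet v ∩ A).ncard : ℝ)}

/-- The `m`-shifted bootstrap process. -/
def bootIterM {V : Type} (G : SimpleGraph V) (m : ℕ) (A0 : Set V) : ℕ → Set V
  | 0 => A0
  | n + 1 => bootStepM G m (bootIterM G m A0 n)

/-- `σ(x) = √(log d(x) / d(x))`. -/
noncomputable def sigma' {V : Type} (G : SimpleGraph V) (x : V) : ℝ :=
  Real.sqrt (Real.log (deg G x) / (deg G x))

/-- `γ(x) = √(d(x) / √(log d(x)))`. -/
noncomputable def gamma' {V : Type} (G : SimpleGraph V) (x : V) : ℝ :=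
  Real.sqrt ((deg G x : ℝ) / Real.sqrt (Real.log (deg G x)))

/-- The `Boot₂(γ)` process: in the step from round `ℓ` to round `ℓ+1`, a vertex `v` becomes
infected if at least `d(v)/2 - max(0, 2-ℓ)·γ(v)` of its neighbours are infected. -/
noncomputable def hatIter {V : Type} (G : SimpleGraph V) (A0 : Set V) : ℕ → Set V
  | 0 => A0
  | ℓ + 1 =>
      hatIter G A0 ℓ ∪
        {v | (deg G v : ℝ) / 2 - ((2 - ℓ : ℕ) : ℝ) * gamma' G v
              ≤ ((G.neighborSet v ∩ hatIter G A0 ℓ).ncard : ℝ)}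

/-- Expectation of `f` restricted to the event `E`, under the `p`-random measure. -/
noncomputable def expOn {V : Type} (p : ℝ) (E : Set V → Prop) (f : Set V → ℝ) : ℝ :=
  ∑ᶠ A ∈ {A : Set V | E A}, weight p A * f A

/-- Conditional expectation of `f` given the event `E`. -/
noncomputable def condExp {V : Type} (p : ℝ) (E : Set V → Prop) (f : Set V → ℝ) : ℝ :=
  expOn p E f / prob p E

/-- Conditional variance of `f` given the event `E`. -/
noncomputable def condVar {V : Type} (p : ℝ) (E : Set V → Prop) (f : Set V → ℝ) : ℝ :=
  condExp p E (fun A => (f A - condExp p E f) ^ 2)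

/-- The number of edges between `U` and `W` (ordered pairs `(u,w)` with `u ∈ U`, `w ∈ W`
adjacent; for disjoint sets this is the number of edges with one endpoint in each). -/
noncomputable def eBetween {V : Type} (G : SimpleGraph V) (U W : Set V) : ℕ :=
  {e : V × V | e.1 ∈ U ∧ e.2 ∈ W ∧ G.Adj e.1 e.2}.ncard

/-- Upper tail `Pr[Bin(d,p) ≥ t]` of the binomial distribution. -/
noncomputable def binTail (d : ℕ) (p : ℝ) (t : ℝ) : ℝ :=
  ∑ k ∈ Finset.range (d + 1),
    if t ≤ (k : ℝ) then (d.choose k : ℝ) * p ^ k * (1 - p) ^ (d - k) else 0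


set_option linter.unusedSectionVars false
section ESsec
variable {V : Type} [DecidableEq V]

/-- Expectation of `f` over a `p`-random subset of the finite set `S`. -/
noncomputable def ES (p : ℝ) (S : Finset V) (f : Finset V → ℝ) : ℝ :=
  ∑ A ∈ S.powerset, p ^ A.card * (1 - p) ^ (S.card - A.card) * f A

lemma ES_empty (p : ℝ) (f : Finset V → ℝ) : ES p ∅ f = f ∅ := by simp [ES]

lemma ES_insert (p : ℝ) {S : Finset V} {v : V} (hv : v ∉ S) (f : Finset V → ℝ) :
    ES p (insert v S) f = p * ES p S (fun A => f (insert v A)) + (1 - p) * ES p S f := by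
  unfold ES
  rw [Finset.sum_powerset_insert hv, add_comm, Finset.mul_sum, Finset.mul_sum]
  congr 1
  · refine Finset.sum_congr rfl fun A hA => ?_
    have hA' := Finset.mem_powerset.1 hA
    have : v ∉ A := fun h => hv (hA' h)
    rw [Finset.card_insert_of_notMem this, Finset.card_insert_of_notMem hv, Nat.add_sub_add_right]
    ring
  · refine Finset.sum_congr rfl fun A hA => ?_
    have := Finset.card_le_card (Finset.mem_powerset.1 hA)
    rw [Finset.card_insert_of_notMem hv, Nat.succ_sub this, pow_succ]
    ring

lemma ES_add (p : ℝ) (S : Finset V) (f g : Finset V → ℝ) :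
    ES p S (fun A => f A + g A) = ES p S f + ES p S g := by
  simp [ES, mul_add, Finset.sum_add_distrib]

lemma ES_sub (p : ℝ) (S : Finset V) (f g : Finset V → ℝ) :
    ES p S (fun A => f A - g A) = ES p S f - ES p S g := by
  simp [ES, mul_sub, Finset.sum_sub_distrib]

lemma ES_mul (p : ℝ) (S : Finset V) (c : ℝ) (f : Finset V → ℝ) :
    ES p S (fun A => c * f A) = c * ES p S f := by
  simp only [ES, Finset.mul_sum]
  exact Finset.sum_congr rfl fun _ _ => by ring

lemma ES_sum {ι : Type*} (p : ℝ) (S : Finset V) (I : Finset ι) (f : ι → Finset V → ℝ) :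
    ES p S (fun A => ∑ i ∈ I, f i A) = ∑ i ∈ I, ES p S (f i) := by
  simp only [ES, Finset.mul_sum]
  exact Finset.sum_comm

lemma ES_const (p : ℝ) (S : Finset V) (c : ℝ) : ES p S (fun _ => c) = c := by
  induction S using Finset.induction_on with
  | empty => simp [ES_empty]
  | insert v S hv ih => rw [ES_insert p hv, ih]; ring

lemma ES_congr (p : ℝ) {S : Finset V} {f g : Finset V → ℝ} (h : ∀ A ⊆ S, f A = g A) :
    ES p S f = ES p S g :=
  Finset.sum_congr rfl fun A hA => by rw [h A (Finset.mem_powerset.1 hA)]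

lemma ES_mono {p : ℝ} (h0 : 0 ≤ p) (h1 : p ≤ 1) {S : Finset V} {f g : Finset V → ℝ}
    (h : ∀ A ⊆ S, f A ≤ g A) : ES p S f ≤ ES p S g :=
  Finset.sum_le_sum fun A hA => mul_le_mul_of_nonneg_left (h A (Finset.mem_powerset.1 hA))
    (mul_nonneg (pow_nonneg h0 _) (pow_nonneg (by linarith) _))

lemma ES_union (p : ℝ) (S : Finset V) {T : Finset V} (hST : Disjoint S T) (f : Finset V → ℝ) :
    ES p (S ∪ T) f = ES p S (fun A => ES p T (fun B => f (A ∪ B))) := by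
  induction T using Finset.induction_on generalizing f with
  | empty => simp [ES_empty]
  | insert v T hv ih =>
    rw [Finset.disjoint_insert_right] at hST
    have h1 : v ∉ S ∪ T := by simp [hST.1, hv]
    rw [Finset.union_insert, ES_insert p h1, ih hST.2, ih hST.2]
    simp_rw [ES_insert p hv, ES_add, ES_mul, Finset.union_insert]

/-- `f` depends only on the coordinates in `S`. -/
def Dep (f : Finset V → ℝ) (S : Finset V) : Prop := ∀ A, f A = f (A ∩ S)

lemma Dep.mono {f : Finset V → ℝ} {S T : Finset V} (h : Dep f S) (hST : S ⊆ T) : Dep f T := by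
  intro A
  rw [h A, h (A ∩ T), Finset.inter_assoc, Finset.inter_eq_right.2 hST]

lemma Dep.mul {f g : Finset V → ℝ} {S : Finset V} (h : Dep f S) (hg : Dep g S) :
    Dep (fun A => f A * g A) S := by
  intro A
  show f A * g A = f (A ∩ S) * g (A ∩ S)
  rw [← h A, ← hg A]

lemma Dep.congr {f : Finset V → ℝ} {S : Finset V} (h : Dep f S) {A B : Finset V}
    (hAB : A ∩ S = B ∩ S) : f A = f B := by rw [h A, h B, hAB]

lemma ES_dep (p : ℝ) {S U : Finset V} (hSU : S ⊆ U) {f : Finset V → ℝ} (hf : Dep f S) :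
    ES p U f = ES p S f := by
  conv_lhs => rw [← Finset.union_sdiff_of_subset hSU]
  rw [ES_union p S Finset.disjoint_sdiff]
  refine ES_congr p fun A hA => ?_
  rw [← ES_const p (U \ S) (f A)]
  refine ES_congr p fun B hB => hf.congr ?_
  ext v
  have h1 := @hA v
  have h2 := @hB v
  simp only [Finset.mem_inter, Finset.mem_union, Finset.mem_sdiff] at *
  tauto

lemma ES_indep (p : ℝ) {S T U : Finset V} (hS : S ⊆ U) (hT : T ⊆ U) (hST : Disjoint S T)
    {f g : Finset V → ℝ} (hf : Dep f S) (hg : Dep g T) :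
    ES p U (fun A => f A * g A) = ES p U f * ES p U g := by
  rw [ES_dep p hS hf, ES_dep p hT hg,
    ES_dep p (Finset.union_subset hS hT)
      ((hf.mono Finset.subset_union_left).mul (hg.mono Finset.subset_union_right)),
    ES_union p S hST, mul_comm, ← ES_mul]
  refine ES_congr p fun A hA => ?_
  rw [mul_comm, ← ES_mul]
  refine ES_congr p fun B hB => ?_
  have hd : ∀ v, v ∈ S → v ∉ T := fun v h => Finset.disjoint_left.1 hST h
  congr 1
  · refine hf.congr ?_
    ext v
    have h1 := @hA v
    have h2 := @hB v
    have := hd v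
    simp only [Finset.mem_inter, Finset.mem_union] at *
    tauto
  · refine hg.congr ?_
    ext v
    have h1 := @hA v
    have h2 := @hB v
    have := hd v
    simp only [Finset.mem_inter, Finset.mem_union] at *
    tauto

lemma Dep.prod {ι : Type*} {F : ι → Finset V → ℝ} {S : Finset V} (I : Finset ι)
    (h : ∀ i ∈ I, Dep (F i) S) : Dep (fun A => ∏ i ∈ I, F i A) S := by
  intro A
  exact Finset.prod_congr rfl fun i hi => h i hi A

lemma ES_prod {ι : Type*} [DecidableEq ι] (p : ℝ) {U : Finset V} (I : Finset ι)
    (F : ι → Finset V → ℝ) (S : ι → Finset V) (hU : ∀ i ∈ I, S i ⊆ U)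
    (hd : ∀ i ∈ I, ∀ j ∈ I, i ≠ j → Disjoint (S i) (S j)) (hF : ∀ i ∈ I, Dep (F i) (S i)) :
    ES p U (fun A => ∏ i ∈ I, F i A) = ∏ i ∈ I, ES p U (F i) := by
  induction I using Finset.induction_on with
  | empty => simp [ES_const]
  | insert i I hi ih =>
    simp only [Finset.prod_insert hi]
    rw [ES_indep p (S := S i) (T := I.biUnion S) (hU i (Finset.mem_insert_self _ _)) ?_ ?_
      (hF i (Finset.mem_insert_self _ _)) ?_, ih]
    · exact fun j hj => hU j (Finset.mem_insert_of_mem hj)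
    · exact fun j hj k hk => hd j (Finset.mem_insert_of_mem hj) k (Finset.mem_insert_of_mem hk)
    · exact fun j hj => hF j (Finset.mem_insert_of_mem hj)
    · exact Finset.biUnion_subset.2 fun j hj => hU j (Finset.mem_insert_of_mem hj)
    · rw [Finset.disjoint_biUnion_right]
      intro j hj
      exact hd i (Finset.mem_insert_self _ _) j (Finset.mem_insert_of_mem hj)
        (by rintro rfl; exact hi hj)
    · exact Dep.prod I fun j hj => (hF j (Finset.mem_insert_of_mem hj)).mono
        (Finset.subset_biUnion_of_mem S hj)

lemma ES_mono_p {p p' : ℝ} (h0 : 0 ≤ p) (hpp : p ≤ p') (h1 : p' ≤ 1) (S : Finset V)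
    (f : Finset V → ℝ) (hf : ∀ A B, A ⊆ B → f B ≤ f A) : ES p' S f ≤ ES p S f := by
  induction S using Finset.induction_on generalizing f with
  | empty => simp [ES_empty]
  | insert v S hv ih =>
    rw [ES_insert p hv, ES_insert p' hv]
    have e1 := ih (fun A => f (insert v A)) fun A B h => hf _ _ (Finset.insert_subset_insert _ h)
    have e2 := ih f hf
    have e3 : ES p S (fun A => f (insert v A)) ≤ ES p S f :=
      ES_mono h0 (hpp.trans h1) fun A _ => hf _ _ (Finset.subset_insert _ _)
    nlinarith [mul_nonneg (sub_nonneg.2 hpp) (sub_nonneg.2 e3),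
      mul_le_mul_of_nonneg_left e1 (h0.trans hpp),
      mul_le_mul_of_nonneg_left e2 (sub_nonneg.2 h1)]

/-- Covariance of two functions sharing at most one coordinate `w`. -/
lemma ES_cov (p : ℝ) {S T U : Finset V} {w : V} (hw : w ∉ S) (hw' : w ∉ T)
    (hST : Disjoint S T) (hU : insert w S ⊆ U) (hU' : insert w T ⊆ U)
    {f g : Finset V → ℝ} (hf : Dep f (insert w S)) (hg : Dep g (insert w T)) :
    ES p U (fun A => f A * g A) - ES p U f * ES p U g =
      p * (1 - p) * (ES p S (fun A => f (insert w A)) - ES p S f) *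
        (ES p T (fun A => g (insert w A)) - ES p T g) := by
  have hw2 : w ∉ S ∪ T := by simp [hw, hw']
  have hsub : insert w (S ∪ T) ⊆ U := by
    intro v hv
    simp only [Finset.mem_insert, Finset.mem_union] at hv
    rcases hv with h | h | h
    · exact hU (by simp [h])
    · exact hU (by simp [h])
    · exact hU' (by simp [h])
  have hfg : Dep (fun A => f A * g A) (insert w (S ∪ T)) :=
    (hf.mono (Finset.insert_subset_insert _ Finset.subset_union_left)).mul
      (hg.mono (Finset.insert_subset_insert _ Finset.subset_union_right))
  -- product structure on `S ∪ T`
  have key : ∀ a b : Finset V → ℝ, (∀ A ⊆ S, ∀ B ⊆ T, a (A ∪ B) = a A ∧ b (A ∪ B) = b B) →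
      ES p (S ∪ T) (fun A => a A * b A) = ES p S a * ES p T b := by
    intro a b h
    rw [ES_union p S hST, mul_comm, ← ES_mul]
    refine ES_congr p fun A hA => ?_
    rw [mul_comm, ← ES_mul]
    exact ES_congr p fun B hB => by rw [(h A hA B hB).1, (h A hA B hB).2]
  have hd : ∀ v, v ∈ S → v ∉ T := fun v h => Finset.disjoint_left.1 hST h
  rw [ES_dep p hU hf, ES_dep p hU' hg, ES_dep p hsub hfg, ES_insert p hw, ES_insert p hw',
    ES_insert p hw2, key f g, key (fun A => f (insert w A)) (fun A => g (insert w A))]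
  · ring
  · intro A hA B hB
    constructor
    · refine hf.congr ?_
      ext v
      have h1 := @hA v
      have h2 := @hB v
      have := hd v
      simp only [Finset.mem_inter, Finset.mem_union, Finset.mem_insert] at *
      tauto
    · refine hg.congr ?_
      ext v
      have h1 := @hA v
      have h2 := @hB v
      have := hd v
      simp only [Finset.mem_inter, Finset.mem_union, Finset.mem_insert] at *
      tauto
  · intro A hA B hB
    constructor
    · refine hf.congr ?_
      ext v
      have h1 := @hA v
      have h2 := @hB v
      have := hd v
      have : v = w → v ∉ T := by rintro rfl; exact hw'
      simp only [Finset.mem_inter, Finset.mem_union, Finset.mem_insert] at *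
      tauto
    · refine hg.congr ?_
      ext v
      have h1 := @hA v
      have h2 := @hB v
      have := hd v
      have : v = w → v ∉ S := by rintro rfl; exact hw
      simp only [Finset.mem_inter, Finset.mem_union, Finset.mem_insert] at *
      tauto

lemma ES_card (p : ℝ) (S : Finset V) (h : ℕ → ℝ) :
    ES p S (fun A => h A.card) =
      ∑ k ∈ Finset.range (S.card + 1), (S.card.choose k : ℝ) * (p ^ k * (1 - p) ^ (S.card - k) * h k) := by
  have := Finset.sum_powerset_apply_card (fun k => p ^ k * (1 - p) ^ (S.card - k) * h k) (x := S)
  simp only [nsmul_eq_mul] at this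
  rw [← this]
  rfl

lemma ES_markov {p : ℝ} (h0 : 0 ≤ p) (h1 : p ≤ 1) {S : Finset V} {f : Finset V → ℝ} {E : Finset V → Prop}
    [DecidablePred E] {a : ℝ} (ha : 0 < a) (hf : ∀ A, 0 ≤ f A) (hE : ∀ A, E A → a ≤ f A) :
    ES p S (fun A => if E A then 1 else 0) ≤ ES p S f / a := by
  rw [le_div_iff₀ ha, mul_comm, ← ES_mul]
  refine ES_mono h0 h1 fun A _ => ?_
  split_ifs with h
  · simpa using hE A h
  · simpa using hf A

end ESsec

lemma prob_eq {V : Type} [Fintype V] [DecidableEq V] (p : ℝ) (E : Set V → Prop)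
    [DecidablePred (fun A : Finset V => E (A : Set V))] :
    prob p E = ES p (Finset.univ : Finset V) (fun A => if E (A : Set V) then 1 else 0) := by
  classical
  unfold prob ES
  rw [finsum_mem_eq_finite_toFinset_sum _ (Set.toFinite _)]
  have : (Set.toFinite {A : Set V | E A}).toFinset =
      ((Finset.univ : Finset V).powerset.filter (fun A : Finset V => E (A : Set V))).map
        ⟨fun A : Finset V => (A : Set V), Finset.coe_injective⟩ := by
    ext A
    simp only [Set.Finite.mem_toFinset, Set.mem_ofPred_eq, Finset.mem_map, Finset.mem_filter,
      Finset.powerset_univ, Finset.mem_univ, true_and, Function.Embedding.coeFn_mk]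
    constructor
    · intro h
      exact ⟨A.toFinset, by simpa using h, by simp⟩
    · rintro ⟨B, h, rfl⟩; exact h
  rw [this, Finset.sum_map, Finset.sum_filter]
  refine Finset.sum_congr rfl fun A _ => ?_
  by_cases h : E (A : Set V)
  · simp only [weight, Function.Embedding.coeFn_mk]
    rw [if_pos h, if_pos h, mul_one, ← Finset.coe_compl, Set.ncard_coe_finset, Set.ncard_coe_finset, Finset.card_compl,
      Finset.card_univ]
  · simp only [if_neg h, mul_zero]


lemma central_lower (n : ℕ) (hn : 1 ≤ n) :
    (4 : ℝ) ^ n ≤ 2 * Real.sqrt n * (Nat.centralBinom n : ℝ) := by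
  have key : ((4 : ℝ) ^ n) ^ 2 ≤ 4 * n * (Nat.centralBinom n : ℝ) ^ 2 := by
    induction n, hn using Nat.le_induction with
    | base => norm_num [Nat.centralBinom, Nat.choose]
    | succ n hn ih =>
      have h := Nat.succ_mul_centralBinom_succ n
      have h' : ((n : ℝ) + 1) * (Nat.centralBinom (n + 1) : ℝ) =
          2 * (2 * n + 1) * (Nat.centralBinom n : ℝ) := by exact_mod_cast h
      have hn' : (0 : ℝ) < n + 1 := by positivity
      have e : (((4 : ℝ) ^ (n + 1)) ^ 2) * (n + 1) ≤
          (4 * (n + 1) * (Nat.centralBinom (n + 1) : ℝ) ^ 2) * (n + 1) := by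
        have : (4 * ((n : ℝ) + 1) * (Nat.centralBinom (n + 1) : ℝ) ^ 2) * (n + 1)
            = 4 * (2 * (2 * n + 1) * (Nat.centralBinom n : ℝ)) ^ 2 := by rw [← h']; ring
        rw [this, pow_succ (4 : ℝ) n]
        have hc : (0 : ℝ) ≤ (Nat.centralBinom n : ℝ) ^ 2 := by positivity
        nlinarith
      push_cast
      exact le_of_mul_le_mul_right e hn'
  apply le_of_sq_le_sq _ (by positivity) |> fun h => h
  rw [mul_pow, mul_pow, Real.sq_sqrt (by positivity)]
  linarith

lemma central_upper (n : ℕ) (hn : 1 ≤ n) :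
    Real.sqrt n * (Nat.centralBinom n : ℝ) ≤ (4 : ℝ) ^ n := by
  have key : (2 * (n : ℝ) + 1) * (Nat.centralBinom n : ℝ) ^ 2 ≤ ((4 : ℝ) ^ n) ^ 2 := by
    clear hn
    induction n with
    | zero => norm_num [Nat.centralBinom, Nat.choose]
    | succ n ih =>
      have h := Nat.succ_mul_centralBinom_succ n
      have h' : ((n : ℝ) + 1) * (Nat.centralBinom (n + 1) : ℝ) =
          2 * (2 * n + 1) * (Nat.centralBinom n : ℝ) := by exact_mod_cast h
      have hn' : (0 : ℝ) < ((n : ℝ) + 1) ^ 2 := by positivity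
      have e : ((2 * ((n : ℝ) + 1) + 1) * (Nat.centralBinom (n + 1) : ℝ) ^ 2) * ((n : ℝ) + 1) ^ 2 ≤
          (((4 : ℝ) ^ (n + 1)) ^ 2) * ((n : ℝ) + 1) ^ 2 := by
        have : ((2 * ((n : ℝ) + 1) + 1) * (Nat.centralBinom (n + 1) : ℝ) ^ 2) * ((n : ℝ) + 1) ^ 2
            = (2 * n + 3) * (2 * (2 * n + 1) * (Nat.centralBinom n : ℝ)) ^ 2 := by rw [← h']; ring
        rw [this, pow_succ (4 : ℝ) n]
        have hc : (0 : ℝ) ≤ (Nat.centralBinom n : ℝ) ^ 2 := by positivity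
        have : (2 * (n : ℝ) + 3) * (2 * (2 * n + 1) * (Nat.centralBinom n : ℝ)) ^ 2
          = 4 * (2 * n + 3) * (2 * n + 1) * ((2 * (n : ℝ) + 1) * (Nat.centralBinom n : ℝ) ^ 2) := by
          ring
        rw [this]
        have h3 : (4 * (2 * (n : ℝ) + 3) * (2 * n + 1)) ≤ 16 * (n + 1) ^ 2 := by nlinarith
        calc _ ≤ (4 * (2 * (n : ℝ) + 3) * (2 * n + 1)) * ((4 : ℝ) ^ n) ^ 2 :=
              mul_le_mul_of_nonneg_left ih (by positivity)
          _ ≤ (16 * (n + 1) ^ 2) * ((4 : ℝ) ^ n) ^ 2 :=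
              mul_le_mul_of_nonneg_right h3 (by positivity)
          _ = _ := by ring
      push_cast
      exact le_of_mul_le_mul_right e hn'
  apply le_of_sq_le_sq _ (by positivity) |> fun h => h
  rw [mul_pow, Real.sq_sqrt (by positivity)]
  have hc : (0 : ℝ) ≤ (Nat.centralBinom n : ℝ) ^ 2 := by positivity
  have : (0 : ℝ) ≤ n := by positivity
  nlinarith

lemma choose_lower (n j : ℕ) (hj : 4 * j ^ 2 ≤ n) :
    (Nat.centralBinom n : ℝ) / 2 ≤ ((2 * n).choose (n + j) : ℝ) := by
  have main : ∀ i : ℕ, i ≤ j →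
      (Nat.centralBinom n : ℝ) * (1 - 2 * (j : ℝ) / n) ^ i ≤ ((2 * n).choose (n + i) : ℝ) := by
    intro i
    induction i with
    | zero => intro _; simp [Nat.centralBinom]
    | succ i ih =>
      intro hi
      have ih := ih (by omega)
      have hjn : 4 * j ≤ n := by nlinarith
      have hn : 0 < n := by omega
      have h := Nat.choose_succ_right_eq (2 * n) (n + i)
      have e : 2 * n - (n + i) = n - i := by omega
      rw [e] at h
      have h' : ((2 * n).choose (n + (i + 1)) : ℝ) * (n + i + 1) =
          ((2 * n).choose (n + i) : ℝ) * (n - i) := by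
        have : ((n - i : ℕ) : ℝ) = n - i := by rw [Nat.cast_sub (by omega)]
        rw [← this]
        exact_mod_cast h
      have hn' : (0 : ℝ) < n := by exact_mod_cast hn
      have hjr : 4 * (j : ℝ) ≤ n := by exact_mod_cast hjn
      have hir : (i : ℝ) + 1 ≤ j := by exact_mod_cast hi
      have hi0 : (0 : ℝ) ≤ i := by positivity
      have r : (1 - 2 * (j : ℝ) / n) * (n + i + 1) ≤ n - i := by
        have : (1 - 2 * (j : ℝ) / n) * (n + i + 1) = n + i + 1 - 2 * j - 2 * j * (i + 1) / n := by
          field_simp; ring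
        rw [this]
        have : 0 ≤ 2 * (j : ℝ) * (i + 1) / n := by positivity
        linarith
      have h1 : 0 ≤ 1 - 2 * (j : ℝ) / n := by
        rw [sub_nonneg, div_le_one hn']; linarith
      rw [pow_succ, ← mul_assoc]
      have hpos : (0 : ℝ) < n + i + 1 := by positivity
      refine le_of_mul_le_mul_right ?_ hpos
      rw [h', mul_assoc]
      calc _ ≤ ((2 * n).choose (n + i) : ℝ) * ((1 - 2 * (j : ℝ) / n) * (n + i + 1)) :=
            mul_le_mul_of_nonneg_right ih (by positivity)
        _ ≤ _ := mul_le_mul_of_nonneg_left r (by positivity)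
  rcases Nat.eq_zero_or_pos j with rfl | hj0
  · simp [Nat.centralBinom]
  have hn : 0 < n := by nlinarith
  have hn' : (0 : ℝ) < n := by exact_mod_cast hn
  have hjr : 4 * (j : ℝ) ^ 2 ≤ n := by exact_mod_cast hj
  have hj1 : (1 : ℝ) ≤ j := by exact_mod_cast hj0
  have b := one_add_mul_le_pow (a := -(2 * (j : ℝ) / n))
    (by
      have : 2 * (j : ℝ) / n ≤ 1 := by rw [div_le_one hn']; nlinarith
      linarith) j
  have : (1 : ℝ) / 2 ≤ 1 + j * (-(2 * (j : ℝ) / n)) := by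
    have : (j : ℝ) * (2 * (j : ℝ) / n) ≤ 1 / 2 := by
      rw [← mul_div_assoc, div_le_iff₀ hn']; nlinarith
    linarith
  have h2 := main j le_rfl
  rw [sub_eq_add_neg] at h2
  calc _ = (Nat.centralBinom n : ℝ) * (1 / 2) := by ring
    _ ≤ _ := mul_le_mul_of_nonneg_left (this.trans b) (by positivity)
    _ ≤ _ := h2

lemma one_sub_exp_lower {x : ℝ} (h0 : 0 ≤ x) (h1 : x ≤ 1 / 2) :
    Real.exp (-x - x ^ 2) ≤ 1 - x := by
  have h := Real.quadratic_le_exp_of_nonneg (x := x + x ^ 2) (by positivity)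
  have : Real.exp (-x - x ^ 2) = (Real.exp (x + x ^ 2))⁻¹ := by rw [← Real.exp_neg]; ring_nf
  rw [this, inv_le_comm₀ (Real.exp_pos _) (by linarith)]
  refine le_trans ?_ h
  rw [inv_le_iff_one_le_mul₀ (by linarith)]
  have h3 : 0 ≤ x ^ 2 * (1 - x - x ^ 2 - x ^ 3) := by
    have h2 : x ^ 2 ≤ 1 / 4 := by nlinarith
    have h3 : x ^ 3 ≤ 1 / 8 := by nlinarith
    exact mul_nonneg (sq_nonneg x) (by linarith)
  linarith [show (1 + (x + x ^ 2) + (x + x ^ 2) ^ 2 / 2) * (1 - x) =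
    1 + x ^ 2 * (1 - x - x ^ 2 - x ^ 3) / 2 by ring]

/-- lower bound on a single binomial probability. -/
lemma binom_term (n j : ℕ) (e : ℝ) (hn : 1 ≤ n) (he : 0 ≤ e) (he1 : e ≤ 1 / 8)
    (hj : 4 * j ^ 2 ≤ n) (hej : e * j ≤ 1 / 8) (hen : 16 * e ^ 4 * n ≤ 1) :
    Real.exp (-4 * e ^ 2 * n) / (24 * Real.sqrt n) ≤
      ((2 * n).choose (n + j) : ℝ) * ((1 / 2 - e) ^ (n + j) * (1 / 2 + e) ^ (n - j)) := by
  have hjn : j ≤ n := by nlinarith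
  have hn' : (0 : ℝ) < n := by exact_mod_cast hn
  have hs : 0 < Real.sqrt n := Real.sqrt_pos.2 hn'
  have e1 : (1 / 2 - e) ^ (n + j) * (1 / 2 + e) ^ (n - j) =
      (1 / 4 : ℝ) ^ n * (1 - 4 * e ^ 2) ^ n * ((1 / 2 - e) / (1 / 2 + e)) ^ j := by
    have hq : (1 / 2 + e) ≠ 0 := by positivity
    have : (1 / 2 + e) ^ n = (1 / 2 + e) ^ (n - j) * (1 / 2 + e) ^ j := by
      rw [← pow_add, Nat.sub_add_cancel hjn]
    have h4 : (1 / 4 : ℝ) ^ n * (1 - 4 * e ^ 2) ^ n = (1 / 2 - e) ^ n * (1 / 2 + e) ^ n := by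
      rw [← mul_pow, ← mul_pow]; congr 1; ring
    rw [h4, this, div_pow, pow_add]
    field_simp
  have e2 : (1 / 2 : ℝ) ≤ ((1 / 2 - e) / (1 / 2 + e)) ^ j := by
    have b := one_add_mul_le_pow (a := -(4 * e)) (by linarith) j
    have h1 : 1 + -(4 * e) ≤ (1 / 2 - e) / (1 / 2 + e) := by
      rw [le_div_iff₀ (by positivity)]; nlinarith
    have h2 : (1 + -(4 * e)) ^ j ≤ ((1 / 2 - e) / (1 / 2 + e)) ^ j :=
      pow_le_pow_left₀ (by linarith) h1 _
    refine le_trans ?_ h2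
    refine le_trans ?_ b
    nlinarith
  have e3 : Real.exp (-4 * e ^ 2 * n) / 3 ≤ (1 - 4 * e ^ 2) ^ n := by
    have h := one_sub_exp_lower (x := 4 * e ^ 2) (by positivity) (by nlinarith)
    have h2 := pow_le_pow_left₀ (Real.exp_pos _).le h n
    refine le_trans ?_ h2
    rw [← Real.exp_nat_mul]
    have : (n : ℝ) * (-(4 * e ^ 2) - (4 * e ^ 2) ^ 2) = -4 * e ^ 2 * n + -(16 * e ^ 4 * n) := by ring
    rw [this, Real.exp_add, div_eq_mul_inv]
    refine mul_le_mul_of_nonneg_left ?_ (Real.exp_pos _).le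
    have h3 : Real.exp (-1) ≤ Real.exp (-(16 * e ^ 4 * n)) := Real.exp_le_exp.2 (by linarith)
    refine le_trans ?_ h3
    rw [Real.exp_neg]
    exact inv_anti₀ (Real.exp_pos _) (Real.exp_one_lt_d9.le.trans (by norm_num))
  have e4 := choose_lower n j hj
  have e5 := central_lower n hn
  have e6 : (4 : ℝ) ^ n / (4 * Real.sqrt n) ≤ ((2 * n).choose (n + j) : ℝ) := by
    refine le_trans ?_ e4
    rw [div_le_iff₀ (by positivity)]; nlinarith
  rw [e1]
  have hA : 0 ≤ Real.exp (-4 * e ^ 2 * n) / 3 := by positivity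
  calc Real.exp (-4 * e ^ 2 * n) / (24 * Real.sqrt n)
      = (4 : ℝ) ^ n / (4 * Real.sqrt n) * ((1 / 4 : ℝ) ^ n * (Real.exp (-4 * e ^ 2 * n) / 3) * (1 / 2)) := by
        have : (4 : ℝ) ^ n * (1 / 4 : ℝ) ^ n = 1 := by rw [← mul_pow]; norm_num
        field_simp
        rw [show (24 : ℝ) * 4 ^ n * (1 / 4) ^ n = 24 * (4 ^ n * (1 / 4) ^ n) by ring, this]; norm_num
    _ ≤ _ := by
        have : 0 ≤ 1 - 4 * e ^ 2 := by nlinarith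
        gcongr


/-- Reduced offset from `1/2`. -/
noncomputable def eps (d : ℕ) : ℝ :=
  Real.sqrt ((Real.log d - 2 * Real.log (Real.log d) - 18) / (4 * d))

lemma tendsto_logcast : Tendsto (fun d : ℕ => Real.log (d : ℝ)) atTop atTop :=
  Real.tendsto_log_atTop.comp tendsto_natCast_atTop_atTop

lemma tendsto_loglogcast : Tendsto (fun d : ℕ => Real.log (Real.log (d : ℝ))) atTop atTop :=
  Real.tendsto_log_atTop.comp tendsto_logcast

lemma ev_log_sq (C : ℝ) (hC : 0 < C) : ∀ᶠ x : ℝ in atTop, C * Real.log x ^ 2 ≤ x := by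
  have h := (Real.isLittleO_pow_log_id_atTop (n := 2)).bound (c := 1 / C) (by positivity)
  filter_upwards [h, eventually_ge_atTop 0] with x hx h0
  simp only [id, Real.norm_eq_abs, abs_of_nonneg h0, abs_of_nonneg (sq_nonneg (Real.log x))] at hx
  rw [one_div, inv_mul_eq_div, le_div_iff₀ hC] at hx
  linarith

lemma ev_base : ∀ᶠ d : ℕ in atTop, 1 ≤ Real.log d ∧
    1 ≤ Real.log d - 2 * Real.log (Real.log d) - 18 ∧ 0 ≤ Real.log (Real.log d) := by
  have h1 := (tendsto_loglogcast.eventually (eventually_ge_atTop 20))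
  have h2 := tendsto_logcast.eventually (ev_log_sq 1 one_pos)
  filter_upwards [h1, h2, tendsto_logcast.eventually (eventually_ge_atTop 1)] with d a b c
  refine ⟨c, ?_, by linarith⟩
  nlinarith

lemma eps_compare (lam : ℝ) (hlam : 1 / 2 < lam) : ∀ᶠ D : ℕ in atTop, ∀ Δ : ℕ, D ≤ Δ →
    1 / 2 - eps D ≤ 1 / 2 - (1 / 2) * Real.sqrt (Real.log Δ / Δ)
      + lam * Real.log (Real.log Δ) / Real.sqrt ((Δ : ℝ) * Real.log Δ) := by
  have h1 := eventually_forall_ge_atTop.2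
    (tendsto_loglogcast.eventually (eventually_ge_atTop (19 / (4 * lam - 2))))
  have h2 := eventually_forall_ge_atTop.2
    (tendsto_logcast.eventually (ev_log_sq (4 * lam ^ 2) (by positivity)))
  filter_upwards [h1, h2, eventually_forall_ge_atTop.2 ev_base, eventually_ge_atTop 1] with D a b c hD1 Δ hΔ
  have a := a Δ hΔ
  have b := b Δ hΔ
  obtain ⟨cL, _, cl⟩ := c Δ hΔ
  obtain ⟨dL, dM, dl⟩ := c D le_rfl
  have hD : (0 : ℝ) < D := by exact_mod_cast hD1
  have hDΔ : (D : ℝ) ≤ Δ := by exact_mod_cast hΔ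
  have hΔ0 : (0 : ℝ) < Δ := by linarith
  rw [div_le_iff₀ (by linarith)] at a
  have hlogs : Real.log D ≤ Real.log Δ := Real.log_le_log hD hDΔ
  have hll : Real.log (Real.log D) ≤ Real.log (Real.log Δ) := Real.log_le_log (by linarith) hlogs
  have hdiff : Real.log Δ ≤ Real.log D + (Δ / D - 1) := by
    have := Real.log_le_sub_one_of_pos (x := (Δ : ℝ) / D) (by positivity)
    rw [Real.log_div hΔ0.ne' hD.ne'] at this
    linarith
  set L := Real.log (Δ : ℝ)
  set ℓ := Real.log L
  set M := Real.log (D : ℝ) - 2 * Real.log (Real.log D) - 18 with hM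
  have hL0 : 0 < L := by linarith
  have hs1 : Real.sqrt (L / Δ) = L / Real.sqrt (Δ * L) := by
    rw [Real.sqrt_div hL0.le, Real.sqrt_mul hΔ0.le]
    have : Real.sqrt L * Real.sqrt L = L := Real.mul_self_sqrt hL0.le
    have h3 : 0 < Real.sqrt L := Real.sqrt_pos.2 hL0
    have h4 : 0 < Real.sqrt Δ := Real.sqrt_pos.2 hΔ0
    rw [div_eq_div_iff h4.ne' (by positivity)]
    nlinarith
  have hsq : ((L - 2 * lam * ℓ) / (2 * Real.sqrt (Δ * L))) ^ 2 ≤ M / (4 * D) := by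
    rw [div_pow, mul_pow, Real.sq_sqrt (by positivity)]
    have s1 : (L - 2 * lam * ℓ) ^ 2 / (2 ^ 2 * (Δ * L)) ≤ (L - 2 * ℓ - 18) / (4 * Δ) := by
      rw [div_le_div_iff₀ (by positivity) (by positivity)]
      have : (L - 2 * lam * ℓ) ^ 2 ≤ (L - 2 * ℓ - 18) * L := by nlinarith
      nlinarith
    refine s1.trans ?_
    rw [div_le_div_iff₀ (by positivity) (by positivity)]
    have h5 : L - 2 * ℓ - 18 ≤ M + (Δ / D - 1) := by linarith
    have h6 : 0 ≤ Δ / D - (1 : ℝ) := by rw [sub_nonneg, one_le_div hD]; exact hDΔ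
    have h7 : L - 2 * ℓ - 18 ≤ M * (Δ / D) := by nlinarith
    have h8 : M * (Δ / D) * D = M * Δ := by field_simp
    nlinarith [mul_le_mul_of_nonneg_right h7 hD.le]
  have := (abs_le.1 (Real.abs_le_sqrt hsq)).2
  have e : (L - 2 * lam * ℓ) / (2 * Real.sqrt (Δ * L)) =
      1 / 2 * Real.sqrt (L / Δ) - lam * ℓ / Real.sqrt (Δ * L) := by
    rw [hs1]; field_simp
  rw [e] at this
  unfold eps
  linarith

lemma eps_basic : ∀ᶠ d : ℕ in atTop, 0 ≤ eps d ∧ eps d ≤ 1 / 8 ∧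
    eps d ≤ 1 / 2 * Real.sqrt (Real.log d / d) ∧
    eps d ^ 2 = (Real.log d - 2 * Real.log (Real.log d) - 18) / (4 * d) := by
  filter_upwards [ev_base, tendsto_natCast_atTop_atTop.eventually (ev_log_sq 16 (by norm_num)),
    eventually_ge_atTop 1] with d ⟨a, b, c⟩ h hd
  have hd0 : (0 : ℝ) < d := by exact_mod_cast hd
  have h3 : eps d ≤ 1 / 2 * Real.sqrt (Real.log d / d) := by
    unfold eps
    apply Real.sqrt_le_iff.2
    refine ⟨by positivity, ?_⟩
    rw [mul_pow, Real.sq_sqrt (by positivity), show (1 / 2 : ℝ) ^ 2 * (Real.log d / d) = Real.log d / (4 * d) by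
      field_simp; norm_num]
    gcongr
    linarith
  refine ⟨Real.sqrt_nonneg _, ?_, h3, Real.sq_sqrt (by positivity)⟩
  refine h3.trans ?_
  have : Real.sqrt (Real.log d / d) ≤ 1 / 4 := by
    apply Real.sqrt_le_iff.2
    refine ⟨by norm_num, ?_⟩
    rw [div_le_iff₀ hd0]; nlinarith
  linarith

set_option maxHeartbeats 1000000 in
lemma tail_lower (K : ℕ) : ∀ᶠ d : ℕ in atTop, ∀ n : ℕ, n = (d - 3 * K) / 2 →
    4 * Real.sqrt (Real.log d / d) ≤ ∑ k ∈ Finset.range (2 * n + 1), ((2 * n).choose k : ℝ) *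
      ((1 / 2 - eps d) ^ k * (1 - (1 / 2 - eps d)) ^ (2 * n - k) *
        if n + (2 * K + 1) ≤ k then 1 else 0) := by
  set M : ℝ := max 32 (16 * (2 * K + 1)) with hMdef
  have hM : 0 < M := lt_of_lt_of_le (by norm_num) (le_max_left _ _)
  filter_upwards [ev_base, eps_basic,
    tendsto_natCast_atTop_atTop.eventually (ev_log_sq 1 one_pos),
    tendsto_natCast_atTop_atTop.eventually (ev_log_sq (M ^ 2) (by positivity)),
    eventually_ge_atTop (6 * K + 10)] with d ⟨a, b, c⟩ ⟨e0, e1, e2, e3⟩ h1 h2 hd n hn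
  have hd0 : (0 : ℝ) < d := by exact_mod_cast (by omega : 0 < d)
  have hL0 : 0 < Real.log d := by linarith
  set L := Real.log (d : ℝ) with hLdef
  set s := Real.sqrt (d / L) with hs
  have hsM : M ≤ s := by
    apply Real.le_sqrt_of_sq_le
    rw [le_div_iff₀ hL0]
    nlinarith [mul_nonneg (sq_nonneg M) (sub_nonneg.2 a)]
  have hs32 : 32 ≤ s := (le_max_left _ _).trans hsM
  have hst : 16 * (2 * (K : ℝ) + 1) ≤ s := (le_max_right _ _).trans hsM
  have hssq : s ^ 2 = d / L := Real.sq_sqrt (by positivity)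
  have hss : Real.sqrt (L / d) = 1 / s := by
    rw [hs, ← inv_div, Real.sqrt_inv, one_div]
  set J := ⌊s / 16⌋₊ with hJ
  have hJ1 : (J : ℝ) ≤ s / 16 := Nat.floor_le (by positivity)
  have hJ2 : s / 32 ≤ J := by
    have := Nat.lt_floor_add_one (s / 16)
    rw [← hJ] at this
    linarith
  have hn4 : d ≤ 4 * n := by omega
  have hn2 : 2 * n ≤ d := by omega
  have hn1 : 1 ≤ n := by omega
  have hn4' : (d : ℝ) ≤ 4 * n := by exact_mod_cast hn4
  have hn2' : 2 * (n : ℝ) ≤ d := by exact_mod_cast hn2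
  have hn0 : (0 : ℝ) < n := by exact_mod_cast hn1
  have hterm : ∀ j : ℕ, j ≤ 2 * K + 1 + J → Real.exp (-4 * eps d ^ 2 * n) / (24 * Real.sqrt n) ≤
      ((2 * n).choose (n + j) : ℝ) * ((1 / 2 - eps d) ^ (n + j) * (1 / 2 + eps d) ^ (n - j)) ∧
      4 * j ^ 2 ≤ n := by
    intro j hj
    have hjs : (j : ℝ) ≤ s / 8 := by
      have : (j : ℝ) ≤ 2 * K + 1 + J := by exact_mod_cast hj
      linarith
    have hj0 : (0 : ℝ) ≤ j := by positivity
    have hdL : d / L ≤ d := div_le_self hd0.le a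
    have hj4 : 4 * j ^ 2 ≤ n := by
      have : 4 * (j : ℝ) ^ 2 ≤ n := by nlinarith
      exact_mod_cast this
    refine ⟨binom_term n j (eps d) hn1 e0 e1 hj4 ?_ ?_, hj4⟩
    · calc eps d * j ≤ (1 / 2 * (1 / s)) * (s / 8) :=
            mul_le_mul (by rw [← hss]; exact e2) hjs hj0 (by positivity)
        _ ≤ 1 / 8 := by
            rw [show 1 / 2 * (1 / s) * (s / 8) = 1 / 16 by field_simp; norm_num]; norm_num
    · have h4 : eps d ^ 2 ≤ L / (4 * d) := by
        rw [e3]; gcongr; linarith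
      have h5 : eps d ^ 4 ≤ (L / (4 * d)) ^ 2 := by
        rw [show eps d ^ 4 = (eps d ^ 2) ^ 2 by ring]
        exact pow_le_pow_left₀ (sq_nonneg _) h4 2
      calc 16 * eps d ^ 4 * n ≤ 16 * (L / (4 * d)) ^ 2 * d := by
            have : (n : ℝ) ≤ d := by linarith
            gcongr
        _ = L ^ 2 / d := by field_simp; norm_num
        _ ≤ 1 := by rw [div_le_one hd0]; linarith
  have hexp : L * 4096 / Real.sqrt d ≤ Real.exp (-4 * eps d ^ 2 * n) := by
    have h6 : -(L / 2) + Real.log L + 9 ≤ -4 * eps d ^ 2 * n := by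
      rw [e3]
      have : (L - 2 * Real.log L - 18) / (4 * d) * (4 * n) ≤ (L - 2 * Real.log L - 18) / (4 * d) * (2 * d) := by
        have hn22 : 4 * (n : ℝ) ≤ 2 * d := by linarith
        exact mul_le_mul_of_nonneg_left hn22 (div_nonneg (by linarith) (by positivity))
      have h7 : (L - 2 * Real.log L - 18) / (4 * d) * (2 * d) = (L - 2 * Real.log L - 18) / 2 := by
        field_simp; norm_num
      linarith
    refine le_trans ?_ (Real.exp_le_exp.2 h6)
    rw [Real.exp_add, Real.exp_add, Real.exp_log hL0, Real.exp_neg]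
    have h8 : Real.exp (L / 2) = Real.sqrt d := by
      rw [Real.exp_half, hLdef, Real.exp_log hd0]
    have h9 : (4096 : ℝ) ≤ Real.exp 9 := by
      have : Real.exp 9 = Real.exp 1 ^ 9 := by rw [← Real.exp_nat_mul]; norm_num
      rw [this]
      have : (2.7 : ℝ) ^ 9 ≤ Real.exp 1 ^ 9 :=
        pow_le_pow_left₀ (by norm_num) (by linarith [Real.exp_one_gt_d9]) 9
      exact le_trans (by norm_num) this
    rw [h8]
    calc L * 4096 / Real.sqrt d = (Real.sqrt d)⁻¹ * L * 4096 := by ring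
      _ ≤ _ := by gcongr
  -- lower bound on the sum
  have hsum : ∑ i ∈ Finset.range J, Real.exp (-4 * eps d ^ 2 * n) / (24 * Real.sqrt n) ≤
      ∑ k ∈ Finset.range (2 * n + 1), ((2 * n).choose k : ℝ) *
      ((1 / 2 - eps d) ^ k * (1 - (1 / 2 - eps d)) ^ (2 * n - k) *
        if n + (2 * K + 1) ≤ k then 1 else 0) := by
    have hsub : Finset.Ico (n + (2 * K + 1)) (n + (2 * K + 1) + J) ⊆ Finset.range (2 * n + 1) := by
      intro k hk
      rw [Finset.mem_Ico] at hk
      rw [Finset.mem_range]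
      have := (hterm (2 * K + 1 + J) le_rfl).2
      have h10 : 2 * K + 1 + J ≤ n := by nlinarith
      omega
    refine le_trans ?_ (Finset.sum_le_sum_of_subset_of_nonneg hsub ?_)
    · rw [Finset.sum_Ico_eq_sum_range]
      rw [Nat.add_sub_cancel_left]
      refine Finset.sum_le_sum fun i hi => ?_
      have hi' := Finset.mem_range.1 hi
      have := (hterm (2 * K + 1 + i) (by omega)).1
      rw [if_pos (by omega), mul_one, show n + (2 * K + 1) + i = n + (2 * K + 1 + i) by ring,
        show 2 * n - (n + (2 * K + 1 + i)) = n - (2 * K + 1 + i) by omega,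
        show 1 - (1 / 2 - eps d) = 1 / 2 + eps d by ring]
      exact this
    · intro k _ _
      have : 0 ≤ 1 / 2 - eps d := by linarith
      have : 0 ≤ 1 - (1 / 2 - eps d) := by linarith
      split_ifs <;> positivity
  refine le_trans ?_ hsum
  rw [Finset.sum_const, Finset.card_range, nsmul_eq_mul, hss]
  have hnd : Real.sqrt n ≤ Real.sqrt d := Real.sqrt_le_sqrt (by linarith)
  have hsn : 0 < Real.sqrt n := Real.sqrt_pos.2 hn0
  have hsd : 0 < Real.sqrt d := Real.sqrt_pos.2 hd0
  calc 4 * (1 / s) ≤ s / 32 * ((L * 4096 / Real.sqrt d) / (24 * Real.sqrt d)) := by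
        have : L * 4096 / Real.sqrt d / (24 * Real.sqrt d) = L * 4096 / (24 * d) := by
          rw [div_div]; congr 1
          rw [show Real.sqrt d * (24 * Real.sqrt d) = 24 * (Real.sqrt d * Real.sqrt d) by ring,
            Real.mul_self_sqrt hd0.le]
        rw [this]
        have hs0 : 0 < s := by linarith
        have h11 : s ^ 2 * L = d := by rw [hssq]; field_simp
        rw [← h11]
        rw [show s / 32 * (L * 4096 / (24 * (s ^ 2 * L))) = (16 / 3) * (1 / s) by field_simp; norm_num]
        have : 0 < 1 / s := by positivity
        linarith
    _ ≤ J * (Real.exp (-4 * eps d ^ 2 * n) / (24 * Real.sqrt n)) := by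
        gcongr


lemma point_mass (n k : ℕ) (hn : 1 ≤ n) (hk : n ≤ k) (p : ℝ) (h0 : 0 ≤ p) (h1 : p ≤ 1 / 2) :
    ((2 * n - 1).choose k : ℝ) * (p ^ k * (1 - p) ^ (2 * n - 1 - k)) ≤ 2 / Real.sqrt n := by
  have hn0 : (0 : ℝ) < n := by exact_mod_cast hn
  have hs : 0 < Real.sqrt n := Real.sqrt_pos.2 hn0
  rcases lt_or_ge (2 * n - 1) k with h | h
  · rw [Nat.choose_eq_zero_of_lt h]
    simp only [Nat.cast_zero, zero_mul]
    positivity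
  have e1 : ((2 * n - 1).choose k : ℝ) ≤ Nat.centralBinom n := by
    have a := Nat.choose_le_choose k (show 2 * n - 1 ≤ 2 * n by omega)
    exact_mod_cast a.trans (Nat.choose_le_centralBinom k n)
  have e2 : p ^ k * (1 - p) ^ (2 * n - 1 - k) ≤ (1 / 2) ^ (2 * n - 1) := by
    obtain ⟨a, ha⟩ : ∃ a, a = 2 * n - 1 - k := ⟨_, rfl⟩
    obtain ⟨b, hb⟩ : ∃ b, k = a + b := ⟨k - a, by omega⟩
    have : 2 * n - 1 = 2 * a + b := by omega
    rw [← ha, this, hb, pow_add, pow_add, pow_mul]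
    calc p ^ a * p ^ b * (1 - p) ^ a = (p * (1 - p)) ^ a * p ^ b := by rw [mul_pow]; ring
      _ ≤ ((1 / 2 : ℝ) ^ 2) ^ a * (1 / 2) ^ b := by
        have : p * (1 - p) ≤ (1 / 2) ^ 2 := by nlinarith [sq_nonneg (p - 1 / 2)]
        have : 0 ≤ p * (1 - p) := mul_nonneg h0 (by linarith)
        gcongr
  have e3 := central_upper n hn
  have e4 : (1 / 2 : ℝ) ^ (2 * n - 1) = 2 / 4 ^ n := by
    have : (1 / 2 : ℝ) ^ (2 * n - 1) * (1 / 2) = (1 / 4) ^ n := by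
      rw [← pow_succ, show 2 * n - 1 + 1 = 2 * n by omega, pow_mul]; norm_num
    have h4 : (2 : ℝ) / 4 ^ n = 2 * (1 / 4) ^ n := by rw [one_div_pow]; ring
    rw [h4, ← this]; ring
  have hq : 0 ≤ 1 - p := by linarith
  calc _ ≤ (Nat.centralBinom n : ℝ) * (2 / 4 ^ n) := by
        rw [← e4]; gcongr
    _ ≤ _ := by
        rw [mul_div_assoc', div_le_div_iff₀ (by positivity) hs]; linarith

section SM
variable {V : Type} [DecidableEq V]

/-- indicator that `y` is not healed in one round: `y ∉ A` and few vertices of `W` lie in `A`. -/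
def gfun (m : ℕ) (W : Finset V) (y : V) (A : Finset V) : ℝ :=
  if y ∈ A then 0 else if m ≤ (A ∩ W).card then 0 else 1

lemma gfun_dep (m : ℕ) (W : Finset V) (y : V) : Dep (gfun m W y) (insert y W) := by
  intro A
  have : A ∩ insert y W ∩ W = A ∩ W := by
    rw [Finset.inter_assoc, Finset.inter_eq_right.2 (Finset.subset_insert y W)]
  simp [gfun, this]

lemma gfun_mem (m : ℕ) (W : Finset V) (y : V) (A : Finset V) :
    0 ≤ gfun m W y A ∧ gfun m W y A ≤ 1 := by
  unfold gfun; split_ifs <;> norm_num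

lemma ES_gfun_aux (p : ℝ) (m : ℕ) (W W' : Finset V) (y : V) (hy : y ∉ W) (hW : W' ⊆ W) :
    ES p (insert y W') (gfun m W y) = (1 - p) * ES p W' (fun A => if m ≤ A.card then 0 else 1) := by
  rw [ES_insert p (fun h => hy (hW h))]
  have : ES p W' (fun A => gfun m W y (insert y A)) = 0 := by
    rw [← ES_const p W' 0]
    exact ES_congr p fun A _ => by simp [gfun]
  rw [this, mul_zero, zero_add]
  congr 1
  refine ES_congr p fun A hA => ?_
  have h1 : y ∉ A := fun h => hy (hW (hA h))
  have h2 : A ∩ W = A := Finset.inter_eq_left.2 (hA.trans hW)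
  simp [gfun, h1, h2]

lemma ES_gfun_aux2 (p : ℝ) (m : ℕ) (W W' : Finset V) (y w : V) (hy : y ∉ W) (hW : W' ⊆ W)
    (hw : w ∈ W) (hw' : w ∉ W') :
    ES p (insert y W') (fun A => gfun m W y (insert w A)) =
      (1 - p) * ES p W' (fun A => if m ≤ A.card + 1 then 0 else 1) := by
  rw [ES_insert p (fun h => hy (hW h))]
  have : ES p W' (fun A => gfun m W y (insert w (insert y A))) = 0 := by
    rw [← ES_const p W' 0]
    exact ES_congr p fun A _ => by simp [gfun]
  rw [this, mul_zero, zero_add]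
  congr 1
  refine ES_congr p fun A hA => ?_
  have h0 : y ≠ w := by rintro rfl; exact hy hw
  have h1 : y ∉ A := fun h => hy (hW (hA h))
  have h3 : w ∉ A := fun h => hw' (hA h)
  have h2 : insert w A ∩ W = insert w A :=
    Finset.inter_eq_left.2 (Finset.insert_subset hw (hA.trans hW))
  simp [gfun, h1, h2, h0, Finset.card_insert_of_notMem h3]

/-- the influence of a coordinate is small -/
lemma gfun_infl (p : ℝ) (h0 : 0 ≤ p) (h1 : p ≤ 1 / 2) (n t : ℕ) (hn : 1 ≤ n) (ht : 1 ≤ t)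
    (W : Finset V) (y w : V) (hy : y ∉ W) (hw : w ∈ W) (hW : W.card = 2 * n) :
    |ES p (insert y (W.erase w)) (fun A => gfun (n + t) W y (insert w A)) -
      ES p (insert y (W.erase w)) (gfun (n + t) W y)| ≤ 2 / Real.sqrt n := by
  rw [ES_gfun_aux p _ W _ y hy (Finset.erase_subset _ _),
    ES_gfun_aux2 p _ W _ y w hy (Finset.erase_subset _ _) hw (Finset.notMem_erase _ _),
    ← mul_sub, ← ES_sub]
  have : (fun A : Finset V => ((if n + t ≤ A.card + 1 then 0 else 1) - (if n + t ≤ A.card then 0 else 1) : ℝ))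
      = fun A => (-1) * (fun k => if k = n + t - 1 then 1 else 0) A.card := by
    funext A
    simp only
    split_ifs <;> first | omega | norm_num
  rw [this, ES_mul, ES_card p _ (fun k => if k = n + t - 1 then 1 else 0)]
  have hc : (W.erase w).card = 2 * n - 1 := by rw [Finset.card_erase_of_mem hw, hW]
  rw [hc]
  have hnn : 0 ≤ 1 - p := by linarith
  set Q := ∑ k ∈ Finset.range (2 * n - 1 + 1), ((2 * n - 1).choose k : ℝ) *
    (p ^ k * (1 - p) ^ (2 * n - 1 - k) * if k = n + t - 1 then 1 else 0) with hQ
  have hQ0 : 0 ≤ Q := Finset.sum_nonneg fun k _ => by split_ifs <;> positivity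
  have hQ1 : Q ≤ 2 / Real.sqrt n := by
    have : Q = if n + t - 1 ∈ Finset.range (2 * n - 1 + 1) then
        ((2 * n - 1).choose (n + t - 1) : ℝ) * (p ^ (n + t - 1) * (1 - p) ^ (2 * n - 1 - (n + t - 1))) else 0 := by
      rw [hQ]
      simp only [mul_ite, mul_one, mul_zero]
      rw [Finset.sum_ite_eq']
    rw [this]
    split_ifs
    · exact point_mass n _ hn (by omega) p h0 h1
    · positivity
  rw [abs_mul, abs_mul, abs_of_nonneg hnn, abs_of_nonneg hQ0, abs_neg, abs_one, one_mul]
  nlinarith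

variable [Fintype V]

lemma ES_gfun (p : ℝ) (n m : ℕ) (W : Finset V) (y : V) (hy : y ∉ W) (hW : W.card = 2 * n) :
    ES p Finset.univ (gfun m W y) = (1 - p) * (1 - ∑ k ∈ Finset.range (2 * n + 1),
      ((2 * n).choose k : ℝ) * (p ^ k * (1 - p) ^ (2 * n - k) * if m ≤ k then 1 else 0)) := by
  rw [ES_dep p (Finset.subset_univ _) (gfun_dep m W y), ES_gfun_aux p m W W y hy subset_rfl]
  congr 1
  have h := ES_card p W (fun k => if m ≤ k then 1 else 0)
  rw [hW] at h
  rw [← h, ← ES_const p W 1, ← ES_sub]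
  refine ES_congr p fun A _ => ?_
  rw [ES_const]
  split_ifs <;> norm_num

lemma gfun_cov (p : ℝ) (h0 : 0 ≤ p) (h1 : p ≤ 1 / 2) (n t : ℕ) (hn : 1 ≤ n) (ht : 1 ≤ t)
    (W W' : Finset V) (y y' : V) (hyy : y ≠ y') (h11 : y ∉ W) (h12 : y ∉ W') (h21 : y' ∉ W)
    (h22 : y' ∉ W') (hW : W.card = 2 * n) (hW' : W'.card = 2 * n) (hi : (W ∩ W').card ≤ 1) :
    ES p Finset.univ (fun A => gfun (n + t) W y A * gfun (n + t) W' y' A) -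
      ES p Finset.univ (gfun (n + t) W y) * ES p Finset.univ (gfun (n + t) W' y') ≤ 1 / n := by
  have hn0 : (0 : ℝ) < n := by exact_mod_cast hn
  rcases Finset.eq_empty_or_nonempty (W ∩ W') with he | ⟨w, hw⟩
  · rw [ES_indep p (Finset.subset_univ _) (Finset.subset_univ _) ?_ (gfun_dep _ W y)
      (gfun_dep _ W' y'), sub_self]
    · positivity
    · rw [Finset.disjoint_left]
      intro v hv hv'
      simp only [Finset.mem_insert] at hv hv'
      rcases hv with rfl | hv <;> rcases hv' with hv' | hv'
      · exact hyy hv'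
      · exact h12 hv'
      · exact h21 (hv' ▸ hv)
      · exact Finset.notMem_empty v (he ▸ Finset.mem_inter.2 ⟨hv, hv'⟩)
  · obtain ⟨hwW, hwW'⟩ := Finset.mem_inter.1 hw
    have hyw : y ≠ w := by rintro rfl; exact h11 hwW
    have hyw' : y' ≠ w := by rintro rfl; exact h22 hwW'
    have uniq : ∀ v, v ∈ W → v ∈ W' → v = w := fun v a b =>
      Finset.card_le_one.1 hi v (Finset.mem_inter.2 ⟨a, b⟩) w hw
    have e1 : insert w (insert y (W.erase w)) = insert y W := by
      rw [Finset.insert_comm, Finset.insert_erase hwW]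
    have e2 : insert w (insert y' (W'.erase w)) = insert y' W' := by
      rw [Finset.insert_comm, Finset.insert_erase hwW']
    rw [ES_cov p (S := insert y (W.erase w)) (T := insert y' (W'.erase w)) (w := w)
      (by simp [Ne.symm hyw]) (by simp [Ne.symm hyw']) ?_ (Finset.subset_univ _)
      (Finset.subset_univ _) (by rw [e1]; exact gfun_dep _ W y) (by rw [e2]; exact gfun_dep _ W' y')]
    · have a := gfun_infl p h0 h1 n t hn ht W y w h11 hwW hW
      have b := gfun_infl p h0 h1 n t hn ht W' y' w h22 hwW' hW'
      have hpq : p * (1 - p) ≤ 1 / 4 := by nlinarith [sq_nonneg (p - 1 / 2)]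
      have hpq0 : 0 ≤ p * (1 - p) := mul_nonneg h0 (by linarith)
      refine (le_abs_self _).trans ?_
      rw [abs_mul, abs_mul, abs_of_nonneg hpq0]
      calc _ ≤ 1 / 4 * (2 / Real.sqrt n) * (2 / Real.sqrt n) := by gcongr
        _ = 1 / (Real.sqrt n * Real.sqrt n) := by
            have : 0 < Real.sqrt n := Real.sqrt_pos.2 hn0
            field_simp; norm_num
        _ = 1 / n := by rw [Real.mul_self_sqrt hn0.le]
    · rw [Finset.disjoint_left]
      intro v hv hv'
      simp only [Finset.mem_insert, Finset.mem_erase] at hv hv'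
      rcases hv with rfl | hv <;> rcases hv' with hv' | hv'
      · exact hyy hv'
      · exact h12 hv'.2
      · exact h21 (hv' ▸ hv.2)
      · exact hv.1 (uniq v hv.2 hv'.2)

lemma second_moment (p : ℝ) (h0 : 0 ≤ p) (h1 : p ≤ 1 / 2) (n t : ℕ) (hn : 1 ≤ n) (ht : 1 ≤ t)
    (N : Finset V) (W : V → Finset V) (hWN : ∀ y ∈ N, ∀ y' ∈ N, y ∉ W y')
    (hW : ∀ y ∈ N, (W y).card = 2 * n)
    (hi : ∀ y ∈ N, ∀ y' ∈ N, y ≠ y' → (W y ∩ W y').card ≤ 1) (μ : ℝ)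
    (hμ : ∀ y ∈ N, ES p Finset.univ (gfun (n + t) (W y) y) = μ) :
    ES p Finset.univ (fun A => ((∑ y ∈ N, gfun (n + t) (W y) y A) - N.card * μ) ^ 2) ≤
      N.card + N.card ^ 2 / n := by
  have hn0 : (0 : ℝ) < n := by exact_mod_cast hn
  have e : ∀ A : Finset V, ((∑ y ∈ N, gfun (n + t) (W y) y A) - N.card * μ) ^ 2 =
      ∑ y ∈ N, ∑ y' ∈ N, (gfun (n + t) (W y) y A - μ) * (gfun (n + t) (W y') y' A - μ) := by
    intro A
    rw [← Finset.sum_mul_sum, ← pow_two, Finset.sum_sub_distrib, Finset.sum_const, nsmul_eq_mul]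
  simp_rw [e]
  rw [ES_sum]
  have bound : ∀ y ∈ N, ∀ y' ∈ N,
      ES p Finset.univ (fun A => (gfun (n + t) (W y) y A - μ) * (gfun (n + t) (W y') y' A - μ)) ≤
        (if y = y' then 1 else 0) + 1 / n := by
    intro y hy y' hy'
    have : ES p Finset.univ (fun A => (gfun (n + t) (W y) y A - μ) * (gfun (n + t) (W y') y' A - μ))
        = ES p Finset.univ (fun A => gfun (n + t) (W y) y A * gfun (n + t) (W y') y' A) - μ * μ := by
      have : (fun A => (gfun (n + t) (W y) y A - μ) * (gfun (n + t) (W y') y' A - μ)) =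
          fun A => (gfun (n + t) (W y) y A * gfun (n + t) (W y') y' A - μ * gfun (n + t) (W y) y A)
            - (μ * gfun (n + t) (W y') y' A - μ * μ) := by funext A; ring
      rw [this, ES_sub, ES_sub, ES_sub, ES_mul, ES_mul, ES_const, hμ y hy, hμ y' hy']; ring
    rw [this]
    by_cases hyy : y = y'
    · rw [if_pos hyy]
      have : ES p Finset.univ (fun A => gfun (n + t) (W y) y A * gfun (n + t) (W y') y' A) ≤ 1 := by
        rw [← ES_const p (Finset.univ : Finset V) 1]
        refine ES_mono h0 (by linarith) fun A _ => ?_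
        exact mul_le_one₀ (gfun_mem _ _ _ _).2 (gfun_mem _ _ _ _).1 (gfun_mem _ _ _ _).2
      have h2 : 0 < 1 / (n : ℝ) := by positivity
      nlinarith [mul_self_nonneg μ]
    · rw [if_neg hyy, zero_add]
      have := gfun_cov p h0 h1 n t hn ht (W y) (W y') y y' hyy (hWN y hy y hy) (hWN y hy y' hy')
        (hWN y' hy' y hy) (hWN y' hy' y' hy') (hW y hy) (hW y' hy') (hi y hy y' hy' hyy)
      rwa [hμ y hy, hμ y' hy'] at this
  calc _ ≤ ∑ y ∈ N, ∑ y' ∈ N, ((if y = y' then 1 else 0) + 1 / (n : ℝ)) := by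
        refine Finset.sum_le_sum fun y hy => ?_
        rw [ES_sum]
        exact Finset.sum_le_sum fun y' hy' => bound y hy y' hy'
    _ = N.card + N.card ^ 2 / n := by
        have : ∀ y ∈ N, ∑ y' ∈ N, ((if y = y' then (1 : ℝ) else 0) + 1 / (n : ℝ)) = 1 + N.card / n := by
          intro y hy
          rw [Finset.sum_add_distrib, Finset.sum_ite_eq, if_pos hy, Finset.sum_const, nsmul_eq_mul]
          ring
        rw [Finset.sum_congr rfl this, Finset.sum_const, nsmul_eq_mul]
        ring

end SM


section Graph
variable {V : Type} {G : SimpleGraph V}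

lemma mem_sphere_one {x y : V} : y ∈ sphere G x 1 ↔ G.Adj x y := by
  show G.edist x y = ((1 : ℕ) : ℕ∞) ↔ _
  rw [Nat.cast_one, SimpleGraph.edist_eq_one_iff_adj]

lemma nbr_ball_or_sphere {x y z : V} {ℓ : ℕ} (hy : y ∈ ball G x ℓ) (hz : G.Adj y z) :
    z ∈ ball G x ℓ ∨ z ∈ sphere G x (ℓ + 1) := by
  have hy' : G.edist x y ≤ ℓ := hy
  have h1 : G.edist y z = 1 := SimpleGraph.edist_eq_one_iff_adj.2 hz
  have h2 : G.edist x z ≤ (ℓ + 1 : ℕ) := by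
    calc G.edist x z ≤ G.edist x y + G.edist y z := SimpleGraph.edist_triangle
      _ ≤ ℓ + 1 := by rw [h1]; gcongr
      _ = _ := by push_cast; rfl
  rcases h2.lt_or_eq with h | h
  · left
    show G.edist x z ≤ ℓ
    rw [Nat.cast_add, Nat.cast_one] at h
    exact Order.le_of_lt_add_one h
  · right; exact h

lemma sphere_subset_ball {x : V} {ℓ : ℕ} : sphere G x ℓ ⊆ ball G x ℓ := fun y hy => by
  have : G.edist x y = ℓ := hy
  exact this.le

lemma ball_mono {x : V} {ℓ m : ℕ} (h : ℓ ≤ m) : ball G x ℓ ⊆ ball G x m := fun y hy => by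
  have : G.edist x y ≤ ℓ := hy
  exact this.trans (by exact_mod_cast h)

lemma bootIter_mono [Finite V] {A B : Set V} (h : A ⊆ B) (k : ℕ) :
    bootIter G A k ⊆ bootIter G B k := by
  induction k with
  | zero => exact h
  | succ k ih =>
    rintro v (hv | hv)
    · exact Or.inl (ih hv)
    · right
      have hv' : (deg G v : ℝ) / 2 ≤ ((G.neighborSet v ∩ bootIter G A k).ncard : ℝ) := hv
      show (deg G v : ℝ) / 2 ≤ ((G.neighborSet v ∩ bootIter G B k).ncard : ℝ)
      refine hv'.trans ?_
      exact_mod_cast Set.ncard_le_ncard (Set.inter_subset_inter_right _ ih) (Set.toFinite _)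

lemma bootIter_local (k : ℕ) : ∀ (v : V) (A B : Set V), A ∩ ball G v k = B ∩ ball G v k →
    (v ∈ bootIter G A k ↔ v ∈ bootIter G B k) := by
  induction k with
  | zero =>
    intro v A B h
    have hv : v ∈ ball G v 0 := by
      show G.edist v v ≤ _
      simp
    have := Set.ext_iff.1 h v
    simp only [Set.mem_inter_iff, hv, and_true] at this
    exact this
  | succ k ih =>
    intro v A B h
    have h1 : v ∈ bootIter G A k ↔ v ∈ bootIter G B k := by
      apply ih
      have hs : ball G v k ⊆ ball G v (k + 1) := ball_mono (Nat.le_succ k)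
      rw [← Set.inter_eq_right.2 hs, ← Set.inter_assoc, ← Set.inter_assoc, h]
    have h2 : G.neighborSet v ∩ bootIter G A k = G.neighborSet v ∩ bootIter G B k := by
      ext w
      simp only [Set.mem_inter_iff, and_congr_right_iff]
      intro hw
      apply ih
      have hs : ball G w k ⊆ ball G v (k + 1) := by
        intro z hz
        have hz' : G.edist w z ≤ k := hz
        have h1 : G.edist v w = 1 := SimpleGraph.edist_eq_one_iff_adj.2 hw
        show G.edist v z ≤ _
        calc G.edist v z ≤ G.edist v w + G.edist w z := SimpleGraph.edist_triangle
          _ ≤ 1 + k := by rw [h1]; gcongr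
          _ = _ := by push_cast; rw [add_comm]
      rw [← Set.inter_eq_right.2 hs, ← Set.inter_assoc, ← Set.inter_assoc, h]
    show (v ∈ bootIter G A k ∨ (deg G v : ℝ) / 2 ≤ ((G.neighborSet v ∩ bootIter G A k).ncard : ℝ)) ↔
      (v ∈ bootIter G B k ∨ (deg G v : ℝ) / 2 ≤ ((G.neighborSet v ∩ bootIter G B k).ncard : ℝ))
    rw [h1, h2]

end Graph

/-- local structure around `x` extracted from (P1)-(P3) -/
lemma local_struct (K : ℕ) {V : Type} [Fintype V] [DecidableEq V] (G : SimpleGraph V)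
    (hP1 : P1 K G) (hP2 : P2 K G) (hP3 : P3 K G) (x : V) (n : ℕ)
    (hn : n = (deg G x - 3 * K) / 2) (hd : 3 * K ≤ deg G x) :
    ∃ (N : Finset V) (W : V → Finset V), N.card ≤ deg G x ∧
      (∀ y ∈ N, ∀ y' ∈ N, y ∉ W y') ∧ (∀ y ∈ N, (W y).card = 2 * n) ∧
      (∀ y ∈ N, ∀ y' ∈ N, y ≠ y' → (W y ∩ W y').card ≤ 1) ∧
      (∀ A : Finset V, x ∉ bootIter G (A : Set V) 2 →
        (deg G x : ℝ) / 2 - 1 ≤ ∑ y ∈ N, gfun (n + (2 * K + 1)) (W y) y A) := by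
  classical
  obtain ⟨B, hxB, hB⟩ := hP3 x
  obtain ⟨b1, b2, b3, -⟩ := hB 1 le_rfl
  simp only [le_refl, Nat.sub_self, pow_zero, mul_one] at b1 b2
  have hS1 : sphere G x 1 = G.neighborSet x := by
    ext y; rw [mem_sphere_one]; rfl
  rw [hS1] at b1 b2 b3
  set N : Finset V := (G.neighborSet x \ B).toFinset with hN
  have memN : ∀ y, y ∈ N ↔ y ∈ G.neighborSet x \ B := fun y => by rw [hN, Set.mem_toFinset]
  have degclose : ∀ y ∈ N, deg G y ≤ deg G x + K ∧ deg G x ≤ deg G y + K := by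
    intro y hy
    have hy' : y ∈ sphere G x 1 := by rw [hS1]; exact ((memN y).1 hy).1
    have := hP1 x 1 le_rfl y hy'
    rw [abs_le] at this
    push_cast at this
    omega
  have hWex : ∀ y, ∃ W : Finset V, y ∈ N →
      ((W : Set V) ⊆ G.neighborSet y ∩ (sphere G x 2 \ B) ∧ W.card = 2 * n) := by
    intro y
    by_cases hy : y ∈ N
    · have hy1 : y ∈ sphere G x 1 := by rw [hS1]; exact ((memN y).1 hy).1
      have c1 : (G.neighborSet y ∩ ball G x 1).ncard ≤ K := by simpa using hP2 x 1 le_rfl y hy1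
      have c2 : (B ∩ G.neighborSet y).ncard ≤ K := b2 y ((memN y).1 hy)
      have hsub : G.neighborSet y ⊆ (G.neighborSet y ∩ (sphere G x 2 \ B)) ∪
          ((G.neighborSet y ∩ ball G x 1) ∪ (B ∩ G.neighborSet y)) := by
        intro z hz
        rcases nbr_ball_or_sphere (sphere_subset_ball hy1) hz with h | h
        · exact Or.inr (Or.inl ⟨hz, h⟩)
        · by_cases hzB : z ∈ B
          · exact Or.inr (Or.inr ⟨hzB, hz⟩)
          · exact Or.inl ⟨hz, h, hzB⟩
      have c3 := Set.ncard_le_ncard hsub (Set.toFinite _)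
      have c4 := Set.ncard_union_le (G.neighborSet y ∩ (sphere G x 2 \ B))
          ((G.neighborSet y ∩ ball G x 1) ∪ (B ∩ G.neighborSet y))
      have c5 := Set.ncard_union_le (G.neighborSet y ∩ ball G x 1) (B ∩ G.neighborSet y)
      have c6 : (G.neighborSet y).ncard = deg G y := rfl
      have c7 := (degclose y hy).2
      have c8 : 2 * n ≤ (G.neighborSet y ∩ (sphere G x 2 \ B)).toFinset.card := by
        rw [← Set.ncard_eq_toFinset_card']
        omega
      obtain ⟨W, hW1, hW2⟩ := Finset.exists_subset_card_eq c8
      refine ⟨W, fun _ => ⟨?_, hW2⟩⟩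
      intro z hz
      exact Set.mem_toFinset.1 (hW1 hz)
    · exact ⟨∅, fun h => absurd h hy⟩
  choose W hW using hWex
  refine ⟨N, W, ?_, ?_, fun y hy => (hW y hy).2, ?_, ?_⟩
  · rw [hN, ← Set.ncard_eq_toFinset_card']
    exact Set.ncard_le_ncard Set.sdiff_subset (Set.toFinite _)
  · intro y hy y' hy' h
    have h2 := ((hW y' hy').1 h).2.1
    have h1 : y ∈ sphere G x 1 := by rw [hS1]; exact ((memN y).1 hy).1
    have h1' : G.edist x y = ((1 : ℕ) : ℕ∞) := h1
    have h2' : G.edist x y = ((2 : ℕ) : ℕ∞) := h2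
    rw [h1'] at h2'
    exact absurd h2' (by norm_num)
  · intro y hy y' hy' hne
    have := b3 y ((memN y).1 hy) y' ((memN y').1 hy') hne
    rw [← Set.ncard_coe_finset]
    refine le_trans (Set.ncard_le_ncard ?_ (Set.toFinite _)) this
    intro z hz
    rw [Finset.coe_inter] at hz
    have z1 := (hW y hy).1 hz.1
    have z2 := (hW y' hy').1 hz.2
    exact ⟨⟨z1.1, z2.1⟩, z1.2⟩
  · intro A hA
    set A1 := bootIter G (A : Set V) 1 with hA1
    have hx : ¬ ((deg G x : ℝ) / 2 ≤ ((G.neighborSet x ∩ A1).ncard : ℝ)) := fun h => hA (Or.inr h)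
    push Not at hx
    have hg : ∀ y ∈ N, (if y ∈ A1 then (0 : ℝ) else 1) ≤ gfun (n + (2 * K + 1)) (W y) y A := by
      intro y hy
      split_ifs with h
      · exact (gfun_mem _ _ _ _).1
      · unfold gfun
        have hyA : y ∉ A := fun h1 => h (Or.inl (Finset.mem_coe.2 h1))
        rw [if_neg hyA, if_neg]
        intro h'
        apply h
        right
        show (deg G y : ℝ) / 2 ≤ ((G.neighborSet y ∩ (A : Set V)).ncard : ℝ)
        have h3 : (A ∩ W y).card ≤ (G.neighborSet y ∩ (A : Set V)).ncard := by
          rw [← Set.ncard_coe_finset]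
          refine Set.ncard_le_ncard ?_ (Set.toFinite _)
          intro z hz
          rw [Finset.coe_inter] at hz
          exact ⟨((hW y hy).1 hz.2).1, hz.1⟩
        have h4 := (degclose y hy).1
        have h5 : deg G y ≤ 2 * (G.neighborSet y ∩ (A : Set V)).ncard := by omega
        have h6 : (deg G y : ℝ) ≤ 2 * ((G.neighborSet y ∩ (A : Set V)).ncard : ℝ) := by exact_mod_cast h5
        linarith
    refine le_trans ?_ (Finset.sum_le_sum hg)
    have hcount : deg G x ≤ (G.neighborSet x ∩ A1).ncard + (N.filter (fun y => y ∉ A1)).card + 1 := by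
      have hsub : G.neighborSet x ⊆ ((G.neighborSet x ∩ A1) ∪ ((N.filter (fun y => y ∉ A1) : Finset V) : Set V)) ∪
          (B ∩ G.neighborSet x) := by
        intro z hz
        by_cases h1 : z ∈ B
        · exact Or.inr ⟨h1, hz⟩
        · by_cases h2 : z ∈ A1
          · exact Or.inl (Or.inl ⟨hz, h2⟩)
          · left; right
            rw [Finset.mem_coe, Finset.mem_filter, memN]
            exact ⟨⟨hz, h1⟩, h2⟩
      have c3 := Set.ncard_le_ncard hsub (Set.toFinite _)
      have c4 := Set.ncard_union_le ((G.neighborSet x ∩ A1) ∪ ((N.filter (fun y => y ∉ A1) : Finset V) : Set V))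
        (B ∩ G.neighborSet x)
      have c5 := Set.ncard_union_le (G.neighborSet x ∩ A1) ((N.filter (fun y => y ∉ A1) : Finset V) : Set V)
      rw [Set.ncard_coe_finset] at c5
      have c6 : (G.neighborSet x).ncard = deg G x := rfl
      omega
    have hsumeq : ∑ y ∈ N, (if y ∈ A1 then (0 : ℝ) else 1) = ((N.filter (fun y => y ∉ A1)).card : ℝ) := by
      rw [Finset.card_filter]
      push_cast
      refine Finset.sum_congr rfl fun y _ => ?_
      by_cases h : y ∈ A1 <;> simp [h]
    rw [hsumeq]
    have : (deg G x : ℝ) ≤ ((G.neighborSet x ∩ A1).ncard : ℝ) + ((N.filter (fun y => y ∉ A1)).card : ℝ) + 1 := by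
      exact_mod_cast hcount
    linarith

set_option maxHeartbeats 2000000 in
open Classical in
lemma stepA (K : ℕ) (η : ℝ) (hη : 0 < η) : ∀ᶠ d : ℕ in atTop,
    ∀ (V : Type) [Fintype V] [DecidableEq V] (G : SimpleGraph V), P1 K G → P2 K G → P3 K G →
    ∀ x : V, deg G x = d → ∀ p : ℝ, 1 / 2 - eps d ≤ p → p ≤ 1 →
      ES p Finset.univ (fun A : Finset V => if x ∉ bootIter G (A : Set V) 2 then (1 : ℝ) else 0) ≤ η := by
  filter_upwards [tail_lower K, eps_basic, ev_base, eventually_ge_atTop (6 * K + 10),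
    tendsto_logcast.eventually (eventually_ge_atTop (5 / η)),
    tendsto_natCast_atTop_atTop.eventually (ev_log_sq 16 (by norm_num))] with
    d htail ⟨e0, e1, e2, _⟩ ⟨l1, _, _⟩ hd hlog hl16 V _ _ G hP1 hP2 hP3 x hx p hp hp1
  set q : ℝ := 1 / 2 - eps d with hq
  have hq0 : 0 ≤ q := by linarith
  have hq2 : q ≤ 1 / 2 := by linarith
  refine (ES_mono_p hq0 hp hp1 Finset.univ _ ?_).trans ?_
  · intro A B hAB
    by_cases h : x ∉ bootIter G (B : Set V) 2
    · rw [if_pos h, if_pos]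
      exact fun h' => h (bootIter_mono (by exact_mod_cast hAB) 2 h')
    · rw [if_neg h]
      split_ifs <;> norm_num
  obtain ⟨n, hn⟩ : ∃ n, n = (d - 3 * K) / 2 := ⟨_, rfl⟩
  obtain ⟨N, W, hNc, hWN, hW, hi, hev⟩ := local_struct K G hP1 hP2 hP3 x n (by rw [hx, hn]) (by omega)
  have hπ := htail n hn
  set π := ∑ k ∈ Finset.range (2 * n + 1), ((2 * n).choose k : ℝ) *
      (q ^ k * (1 - q) ^ (2 * n - k) * if n + (2 * K + 1) ≤ k then 1 else 0) with hπdef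
  set μ := (1 - q) * (1 - π) with hμ
  set t := 2 * K + 1 with ht
  have hn1 : 1 ≤ n := by omega
  have hmom := second_moment q hq0 hq2 n t hn1 (by omega) N W hWN hW hi μ
    (fun y hy => ES_gfun q n (n + t) (W y) y (hWN y hy y hy) (hW y hy))
  set r := Real.sqrt (Real.log d / d) with hr
  have hd0 : (0 : ℝ) < d := by exact_mod_cast (by omega : 0 < d)
  have hr0 : 0 ≤ r := Real.sqrt_nonneg _
  have hrsq : r ^ 2 * d = Real.log d := by
    rw [hr, Real.sq_sqrt (by positivity)]; field_simp
  have hdr : 2 ≤ d * r := by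
    have hd10 : (10 : ℝ) ≤ d := by exact_mod_cast (by omega : 10 ≤ d)
    have : 2 ^ 2 ≤ (d * r) ^ 2 := by
      rw [show (d * r) ^ 2 = d * (r ^ 2 * d) by ring, hrsq]; nlinarith
    exact le_of_sq_le_sq this (by positivity)
  have hμle : μ ≤ 1 / 2 - 3 / 2 * r := by
    have hq' : 1 - q = 1 / 2 + eps d := by rw [hq]; ring
    rw [hμ, hq']
    have : 0 ≤ eps d * π := mul_nonneg e0 (by linarith)
    nlinarith
  have hμ0 : (0 : ℝ) ≤ μ ∨ μ < 0 := le_or_gt _ _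
  have hN' : (N.card : ℝ) ≤ d := by rw [← hx]; exact_mod_cast hNc
  clear_value μ π
  have hNμ : N.card * μ ≤ d * (1 / 2) - 3 / 2 * (d * r) ∨ N.card * μ ≤ 0 := by
    rcases hμ0 with h | h
    · left; calc N.card * μ ≤ d * μ := by gcongr
        _ ≤ d * (1 / 2 - 3 / 2 * r) := by gcongr
        _ = _ := by ring
    · right; exact mul_nonpos_of_nonneg_of_nonpos (Nat.cast_nonneg _) h.le
  have hdr2 : d * r ≤ d / 2 - 1 ∨ d / 2 - 1 < d * r := le_or_gt _ _
  have hrsmall : d * r ≤ d / 4 ∧ (10 : ℝ) ≤ d := by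
    refine ⟨?_, by exact_mod_cast (by omega : 10 ≤ d)⟩
    have : r ≤ 1 / 4 := by
      rw [hr, Real.sqrt_le_iff]
      refine ⟨by norm_num, ?_⟩
      rw [div_le_iff₀ hd0]
      nlinarith
    nlinarith
  have hdrsq : 0 < (d * r) ^ 2 := by
    have : 0 < d * r := by linarith
    exact pow_pos this 2
  have hkey : ∀ A : Finset V, x ∉ bootIter G (A : Set V) 2 →
      (d * r) ^ 2 ≤ ((∑ y ∈ N, gfun (n + t) (W y) y A) - N.card * μ) ^ 2 := by
    intro A hA
    have h1 := hev A hA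
    rw [hx] at h1
    have hdr0 : 0 ≤ d * r := by linarith
    refine pow_le_pow_left₀ hdr0 ?_ 2
    generalize (∑ y ∈ N, gfun (n + t) (W y) y A) = s at *
    obtain ⟨h2, h3⟩ := hrsmall
    generalize (N.card : ℝ) * μ = m at *
    generalize (d : ℝ) * r = u at *
    rcases hNμ with h | h
    · clear * - h1 h hdr
      linarith
    · clear * - h1 h h2 h3
      linarith
  have hmark := ES_markov (p := q) hq0 (by linarith) (S := (Finset.univ : Finset V))
    (f := fun A => ((∑ y ∈ N, gfun (n + t) (W y) y A) - N.card * μ) ^ 2)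
    (E := fun A : Finset V => x ∉ bootIter G (A : Set V) 2) (a := (d * r) ^ 2)
    hdrsq (fun A => sq_nonneg _) hkey
  refine hmark.trans ?_
  rw [div_le_iff₀ hdrsq]
  refine hmom.trans ?_
  have hn4 : (d : ℝ) ≤ 4 * n := by exact_mod_cast (by omega : d ≤ 4 * n)
  have hn0 : (0 : ℝ) < n := by exact_mod_cast hn1
  have h5 : (N.card : ℝ) ^ 2 / n ≤ 4 * d := by
    rw [div_le_iff₀ hn0]
    have : (N.card : ℝ) ^ 2 ≤ d ^ 2 := pow_le_pow_left₀ (Nat.cast_nonneg _) hN' 2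
    clear * - this hn4 hd0
    nlinarith
  have h6 : η * (d * r) ^ 2 = d * (η * Real.log d) := by rw [← hrsq]; ring
  rw [h6]
  rw [div_le_iff₀ hη] at hlog
  have h7 : (d : ℝ) * 5 ≤ d * (η * Real.log d) :=
    mul_le_mul_of_nonneg_left (by rw [mul_comm η]; exact hlog) hd0.le
  linarith only [h7, h5, hN']


section Det
variable {V : Type} {G : SimpleGraph V}

lemma growth [Fintype V] (K : ℕ) (hP1 : P1 K G) (hP2 : P2 K G) (x : V) (ℓ : ℕ) (hℓ : 1 ≤ ℓ)
    (S : Set V) (m : ℕ) (hm : 2 * m + 3 * (K * ℓ) ≤ deg G x) :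
    (sphere G x ℓ \ bootStep G S).ncard * m ≤ (sphere G x (ℓ + 1) \ S).ncard * (K * (ℓ + 1)) := by
  classical
  rw [Set.ncard_eq_toFinset_card', Set.ncard_eq_toFinset_card']
  refine Finset.card_mul_le_card_mul (fun y z => G.Adj y z) ?_ ?_
  · intro y hy
    rw [Set.mem_toFinset] at hy
    obtain ⟨hy1, hy2⟩ := hy
    have h1 : ¬ ((deg G y : ℝ) / 2 ≤ ((G.neighborSet y ∩ S).ncard : ℝ)) := fun h => hy2 (Or.inr h)
    push Not at h1
    have h2 : 2 * (G.neighborSet y ∩ S).ncard < deg G y := by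
      have : 2 * ((G.neighborSet y ∩ S).ncard : ℝ) < deg G y := by linarith
      exact_mod_cast this
    have h3 := hP1 x ℓ hℓ y hy1
    rw [abs_le] at h3
    have h4 := hP2 x ℓ hℓ y hy1
    have hsub : G.neighborSet y ⊆ ((G.neighborSet y ∩ S) ∪ (G.neighborSet y ∩ ball G x ℓ)) ∪
        ((Finset.bipartiteAbove (fun y z => G.Adj y z) (sphere G x (ℓ + 1) \ S).toFinset y : Finset V) : Set V) := by
      intro z hz
      by_cases hzS : z ∈ S
      · exact Or.inl (Or.inl ⟨hz, hzS⟩)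
      · rcases nbr_ball_or_sphere (sphere_subset_ball hy1) hz with h | h
        · exact Or.inl (Or.inr ⟨hz, h⟩)
        · right
          rw [Finset.mem_coe, Finset.mem_bipartiteAbove, Set.mem_toFinset]
          exact ⟨⟨h, hzS⟩, hz⟩
    have c3 := Set.ncard_le_ncard hsub (Set.toFinite _)
    have c4 := Set.ncard_union_le ((G.neighborSet y ∩ S) ∪ (G.neighborSet y ∩ ball G x ℓ))
      ((Finset.bipartiteAbove (fun y z => G.Adj y z) (sphere G x (ℓ + 1) \ S).toFinset y : Finset V) : Set V)
    have c5 := Set.ncard_union_le (G.neighborSet y ∩ S) (G.neighborSet y ∩ ball G x ℓ)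
    rw [Set.ncard_coe_finset] at c4
    have c6 : (G.neighborSet y).ncard = deg G y := rfl
    have h3' := h3.2
    have h5 : (deg G x : ℤ) - deg G y ≤ ((K * ℓ : ℕ) : ℤ) := by push_cast; exact h3'
    generalize K * ℓ = kl at *
    omega
  · intro z hz
    rw [Set.mem_toFinset] at hz
    refine le_trans ?_ (hP2 x (ℓ + 1) (by omega) z hz.1)
    rw [← Set.ncard_coe_finset]
    refine Set.ncard_le_ncard ?_ (Set.toFinite _)
    intro y hy
    rw [Finset.mem_coe, Finset.mem_bipartiteBelow, Set.mem_toFinset] at hy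
    exact ⟨hy.2.symm, ball_mono (Nat.le_succ ℓ) (sphere_subset_ball hy.1.1)⟩

lemma sphere_pred {x z : V} {ℓ : ℕ} (h : z ∈ sphere G x (ℓ + 1)) :
    ∃ y ∈ sphere G x ℓ, G.Adj y z := by
  have h' : G.edist x z = ((ℓ + 1 : ℕ) : ℕ∞) := h
  have hr : G.Reachable z x := by
    apply SimpleGraph.Reachable.symm
    rw [← SimpleGraph.edist_ne_top_iff_reachable, h']
    exact ENat.natCast_ne_top _
  obtain ⟨w, hw⟩ := hr.exists_walk_length_eq_edist
  rw [SimpleGraph.edist_comm, h'] at hw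
  have hw' : w.length = ℓ + 1 := by exact_mod_cast hw
  cases w with
  | nil => simp at hw'
  | @cons _ y _ ha q =>
    rw [SimpleGraph.Walk.length_cons] at hw'
    have hq : q.length = ℓ := by omega
    refine ⟨y, ?_, ha.symm⟩
    show G.edist x y = ℓ
    apply le_antisymm
    · rw [SimpleGraph.edist_comm, ← hq]
      exact SimpleGraph.edist_le q
    · have h1 : G.edist y z = 1 := SimpleGraph.edist_eq_one_iff_adj.2 ha.symm
      have h2 : G.edist x z ≤ G.edist x y + G.edist y z := SimpleGraph.edist_triangle
      rw [h1, h', Nat.cast_add, Nat.cast_one] at h2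
      exact (ENat.add_le_add_iff_right (by simp)).1 h2

lemma sphere_card_succ [Fintype V] (K : ℕ) (hP1 : P1 K G) (x : V) (ℓ : ℕ) (hℓ : 1 ≤ ℓ) :
    (sphere G x (ℓ + 1)).ncard ≤ (sphere G x ℓ).ncard * (deg G x + K * ℓ) := by
  classical
  rw [Set.ncard_eq_toFinset_card', Set.ncard_eq_toFinset_card']
  have := Finset.card_mul_le_card_mul (s := (sphere G x (ℓ + 1)).toFinset) (t := (sphere G x ℓ).toFinset)
    (fun z y => G.Adj y z) (m := 1) (n := deg G x + K * ℓ) ?_ ?_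
  · simpa using this
  · intro z hz
    rw [Set.mem_toFinset] at hz
    obtain ⟨y, hy, ha⟩ := sphere_pred hz
    refine Finset.card_pos.2 ⟨y, ?_⟩
    rw [Finset.mem_bipartiteAbove, Set.mem_toFinset]
    exact ⟨hy, ha⟩
  · intro y hy
    rw [Set.mem_toFinset] at hy
    have h3 := hP1 x ℓ hℓ y hy
    rw [abs_le] at h3
    have h5 : (deg G y : ℤ) ≤ ((deg G x + K * ℓ : ℕ) : ℤ) := by push_cast; linarith [h3.1]
    have h6 : deg G y ≤ deg G x + K * ℓ := by exact_mod_cast h5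
    refine le_trans ?_ h6
    rw [← Set.ncard_coe_finset]
    refine Set.ncard_le_ncard ?_ (Set.toFinite _)
    intro z hz
    rw [Finset.mem_coe, Finset.mem_bipartiteBelow] at hz
    exact hz.2

lemma sphere_one_eq (x : V) : sphere G x 1 = G.neighborSet x := by
  ext y; rw [mem_sphere_one]; rfl

lemma sphere3_card [Fintype V] (K : ℕ) (hP1 : P1 K G) (x : V) (hK : 2 * K ≤ deg G x) :
    (sphere G x 3).ncard ≤ 4 * deg G x ^ 3 := by
  have h1 : (sphere G x 1).ncard = deg G x := by rw [sphere_one_eq]; rfl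
  have h2 := sphere_card_succ K hP1 x 1 le_rfl
  have h3 := sphere_card_succ K hP1 x 2 (by norm_num)
  norm_num at h2 h3
  rw [h1] at h2
  generalize deg G x = d at *
  calc (sphere G x 3).ncard ≤ _ := h3
    _ ≤ (d * (2 * d)) * (2 * d) := by
        refine Nat.mul_le_mul (h2.trans (Nat.mul_le_mul le_rfl (by omega))) (by omega)
    _ = _ := by ring

open Classical in
lemma many_uninf [Fintype V] (K : ℕ) (hP1 : P1 K G) (hP2 : P2 K G) (x : V) (B : Set V)
    (hB : (B ∩ sphere G x 3).ncard ≤ K ^ 2 * deg G x ^ 2)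
    (hd1 : 12 * K + 3 ≤ deg G x) (hd2 : 384 * K ^ 4 ≤ deg G x) (A : Set V)
    (hx : x ∉ bootIter G A 5) :
    deg G x ^ 3 ≤ 384 * K ^ 2 * (((sphere G x 3 \ B).toFinset).filter (fun v => v ∉ bootIter G A 2)).card := by
  obtain ⟨m, hm⟩ : ∃ m, m = (deg G x + 3) / 4 := ⟨_, rfl⟩
  have g1 := growth K hP1 hP2 x 1 le_rfl (bootIter G A 3) m (by omega)
  have g2 := growth K hP1 hP2 x 2 (by norm_num) (bootIter G A 2) m (by omega)
  have hx' : ¬ ((deg G x : ℝ) / 2 ≤ ((G.neighborSet x ∩ bootIter G A 4).ncard : ℝ)) :=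
    fun h => hx (Or.inr h)
  push Not at hx'
  have h2 : 2 * (G.neighborSet x ∩ bootIter G A 4).ncard < deg G x := by
    have : 2 * ((G.neighborSet x ∩ bootIter G A 4).ncard : ℝ) < deg G x := by linarith
    exact_mod_cast this
  have h0 : (G.neighborSet x ∩ bootIter G A 4).ncard + (G.neighborSet x \ bootIter G A 4).ncard = deg G x :=
    Set.ncard_inter_add_ncard_sdiff_eq_ncard _ _ (Set.toFinite _)
  have g1' : (G.neighborSet x \ bootIter G A 4).ncard * m ≤ (sphere G x 2 \ bootIter G A 3).ncard * (K * 2) := by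
    rw [← sphere_one_eq]; exact g1
  have g2' : (sphere G x 2 \ bootIter G A 3).ncard * m ≤ (sphere G x 3 \ bootIter G A 2).ncard * (K * 3) := g2
  have g3 : (sphere G x 3 \ bootIter G A 2).ncard ≤
      (((sphere G x 3 \ B).toFinset).filter (fun v => v ∉ bootIter G A 2)).card + K ^ 2 * deg G x ^ 2 := by
    have hsub : sphere G x 3 \ bootIter G A 2 ⊆
      ((((sphere G x 3 \ B).toFinset).filter (fun v => v ∉ bootIter G A 2) : Finset V) : Set V) ∪ (B ∩ sphere G x 3) := by
      intro z hz
      by_cases h : z ∈ B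
      · exact Or.inr ⟨h, hz.1⟩
      · left
        rw [Finset.mem_coe, Finset.mem_filter, Set.mem_toFinset]
        exact ⟨⟨hz.1, h⟩, hz.2⟩
    have c1 := Set.ncard_le_ncard hsub (Set.toFinite _)
    have c2 := Set.ncard_union_le ((((sphere G x 3 \ B).toFinset).filter (fun v => v ∉ bootIter G A 2) : Finset V) : Set V)
      (B ∩ sphere G x 3)
    rw [Set.ncard_coe_finset] at c2
    omega
  generalize (((sphere G x 3 \ B).toFinset).filter (fun v => v ∉ bootIter G A 2)).card = u at *
  generalize (sphere G x 3 \ bootIter G A 2).ncard = u3 at *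
  generalize (sphere G x 2 \ bootIter G A 3).ncard = u2 at *
  have hu1 : deg G x ≤ 2 * (G.neighborSet x \ bootIter G A 4).ncard := by omega
  generalize (G.neighborSet x \ bootIter G A 4).ncard = u1 at *
  generalize deg G x = d at *
  have hdm : d ≤ 4 * m := by omega
  have k1 : d ^ 3 ≤ 192 * K ^ 2 * u3 := by
    calc d ^ 3 = d * d * d := by ring
      _ ≤ (2 * u1) * (4 * m) * (4 * m) := by gcongr
      _ = 32 * (u1 * m) * m := by ring
      _ ≤ 32 * (u2 * (K * 2)) * m := by gcongr
      _ = 64 * K * (u2 * m) := by ring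
      _ ≤ 64 * K * (u3 * (K * 3)) := by gcongr
      _ = _ := by ring
  have k2 : 192 * K ^ 2 * u3 ≤ 192 * K ^ 2 * (u + K ^ 2 * d ^ 2) := by gcongr
  have k3 : 384 * K ^ 4 * d ^ 2 ≤ d * d ^ 2 := by gcongr
  nlinarith

lemma greedy {V : Type} [DecidableEq V] (R : V → V → Prop) [DecidableRel R] (hsym : ∀ a b, R a b → R b a)
    (hrefl : ∀ a, R a a) (M : ℕ) (S : Finset V) :
    (∀ y ∈ S, (S.filter (R y)).card ≤ M) →
    ∃ c : V → ℕ, (∀ y ∈ S, c y < M) ∧ ∀ y ∈ S, ∀ z ∈ S, y ≠ z → R y z → c y ≠ c z := by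
  induction S using Finset.induction_on with
  | empty => intro _; exact ⟨fun _ => 0, by simp, by simp⟩
  | insert a S ha ih =>
    intro h
    obtain ⟨c, hc1, hc2⟩ := ih (fun y hy => le_trans (Finset.card_le_card
      (Finset.filter_subset_filter _ (Finset.subset_insert a S))) (h y (Finset.mem_insert_of_mem hy)))
    have h1 := h a (Finset.mem_insert_self a S)
    rw [Finset.filter_insert, if_pos (hrefl a), Finset.card_insert_of_notMem
      (fun h => ha (Finset.mem_filter.1 h).1)] at h1
    have h2 : ((S.filter (R a)).image c).card < (Finset.range M).card := by
      rw [Finset.card_range]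
      exact lt_of_le_of_lt Finset.card_image_le (by omega)
    obtain ⟨k, hk1, hk2⟩ := Finset.exists_mem_notMem_of_card_lt_card h2
    have hne : ∀ y ∈ S, y ≠ a := fun y hy h => ha (h ▸ hy)
    have hk3 : ∀ z ∈ S, R a z → c z ≠ k := fun z hz hR h =>
      hk2 (Finset.mem_image.2 ⟨z, Finset.mem_filter.2 ⟨hz, hR⟩, h⟩)
    refine ⟨Function.update c a k, ?_, ?_⟩
    · intro y hy
      rcases Finset.mem_insert.1 hy with rfl | hy
      · rw [Function.update_self]; exact Finset.mem_range.1 hk1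
      · rw [Function.update_of_ne (hne y hy)]; exact hc1 y hy
    · intro y hy z hz hyz hR
      rcases Finset.mem_insert.1 hy with hya | hy1 <;> rcases Finset.mem_insert.1 hz with hza | hz1
      · exact absurd (hya.trans hza.symm) hyz
      · subst hya
        rw [Function.update_self, Function.update_of_ne (hne z hz1)]
        exact (hk3 z hz1 hR).symm
      · subst hza
        rw [Function.update_self, Function.update_of_ne (hne y hy1)]
        exact hk3 y hy1 (hsym _ _ hR)
      · rw [Function.update_of_ne (hne y hy1), Function.update_of_ne (hne z hz1)]
        exact hc2 y hy1 z hz1 hyz hR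

end Det

lemma chernoff {V : Type} [Fintype V] [DecidableEq V] {p : ℝ} (h0 : 0 ≤ p) (h1 : p ≤ 1)
    (C : Finset V) (f : V → Finset V → ℝ) (S : V → Finset V) (hf : ∀ v A, f v A = 0 ∨ f v A = 1)
    (hdep : ∀ v ∈ C, Dep (f v) (S v)) (hdis : ∀ v ∈ C, ∀ w ∈ C, v ≠ w → Disjoint (S v) (S w))
    (η θ a : ℝ) (hE : ∀ v ∈ C, ES p Finset.univ (f v) ≤ η) (hθ : 0 < θ) :
    ES p Finset.univ (fun A => if a ≤ ∑ v ∈ C, f v A then (1 : ℝ) else 0) ≤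
      Real.exp (Real.exp θ * η * C.card - θ * a) := by
  classical
  have hm := ES_markov (p := p) h0 h1 (S := (Finset.univ : Finset V))
    (f := fun A => ∏ v ∈ C, (1 + Real.exp θ * f v A)) (a := Real.exp (θ * a))
    (E := fun A => a ≤ ∑ v ∈ C, f v A) (Real.exp_pos _) (fun A => Finset.prod_nonneg fun v _ => by
      rcases hf v A with h | h <;> rw [h] <;> positivity) (fun A hA => by
      calc Real.exp (θ * a) ≤ Real.exp (θ * ∑ v ∈ C, f v A) := by
            apply Real.exp_le_exp.2; gcongr
        _ = ∏ v ∈ C, Real.exp (θ * f v A) := by rw [Finset.mul_sum, Real.exp_sum]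
        _ ≤ _ := by
            refine Finset.prod_le_prod (fun v _ => (Real.exp_pos _).le) fun v _ => ?_
            rcases hf v A with h | h <;> rw [h] <;> simp)
  refine hm.trans ?_
  rw [ES_prod p C (fun v A => 1 + Real.exp θ * f v A) S (fun v _ => Finset.subset_univ _) hdis ?_]
  · rw [Real.exp_sub]
    gcongr
    have : ∀ v ∈ C, ES p Finset.univ (fun A => 1 + Real.exp θ * f v A) ≤ Real.exp (Real.exp θ * η) := by
      intro v hv
      rw [ES_add p _ (fun _ => 1) (fun A => Real.exp θ * f v A), ES_const, ES_mul]
      have h2 := Real.add_one_le_exp (Real.exp θ * η)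
      have h3 : Real.exp θ * ES p Finset.univ (f v) ≤ Real.exp θ * η := by gcongr; exact hE v hv
      linarith
    calc ∏ v ∈ C, ES p Finset.univ (fun A => 1 + Real.exp θ * f v A) ≤ ∏ v ∈ C, Real.exp (Real.exp θ * η) := by
          refine Finset.prod_le_prod (fun v _ => ?_) this
          rw [← ES_const p (Finset.univ : Finset V) (0 : ℝ)]
          refine ES_mono h0 h1 fun A _ => ?_
          rcases hf v A with h | h <;> rw [h] <;> positivity
      _ = _ := by rw [Finset.prod_const, ← Real.exp_nat_mul]; ring_nf
  · intro v hv A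
    show 1 + Real.exp θ * f v A = 1 + Real.exp θ * f v (A ∩ S v)
    rw [hdep v hv A]


open Classical in
lemma stepB (K : ℕ) (hK : 1 ≤ K) : ∃ η : ℝ, 0 < η ∧ ∀ᶠ d : ℕ in atTop,
    ∀ (V : Type) [Fintype V] [DecidableEq V] (G : SimpleGraph V), P1 K G → P2 K G → P3 K G →
    ∀ x : V, deg G x = d → ∀ p : ℝ, 0 ≤ p → p ≤ 1 →
      (∀ v : V, ES p Finset.univ (fun A : Finset V => if v ∉ bootIter G (A : Set V) 2 then (1 : ℝ) else 0) ≤ η) →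
      ES p Finset.univ (fun A : Finset V => if x ∉ bootIter G (A : Set V) 5 then (1 : ℝ) else 0) ≤
        Real.exp (-((K + 1) * d)) := by
  have hKr : (1 : ℝ) ≤ K := by exact_mod_cast hK
  have hK0 : (0 : ℝ) < K := by linarith
  obtain ⟨c, hc⟩ : ∃ c : ℝ, c = 1 / (384 * K ^ 2) := ⟨_, rfl⟩
  have hc0 : 0 < c := by rw [hc]; positivity
  obtain ⟨α, hα⟩ : ∃ α : ℝ, α = c / 8 := ⟨_, rfl⟩
  obtain ⟨β, hβ⟩ : ∃ β : ℝ, β = c / (6 * K ^ 2) := ⟨_, rfl⟩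
  have hα0 : 0 < α := by rw [hα]; positivity
  have hβ0 : 0 < β := by rw [hβ]; positivity
  obtain ⟨θ, hθ⟩ : ∃ θ : ℝ, θ = (K + 2) / β := ⟨_, rfl⟩
  have hθ0 : 0 < θ := by rw [hθ]; positivity
  refine ⟨θ * α * Real.exp (-θ), by positivity, ?_⟩
  filter_upwards [eventually_ge_atTop (12 * K + 3), eventually_ge_atTop (384 * K ^ 4),
    eventually_ge_atTop (18 * K ^ 2)] with d hd1 hd2 hd3 V _ _ G hP1 hP2 hP3 x hx p h0 h1 hη
  obtain ⟨B, hxB, hB⟩ := hP3 x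
  obtain ⟨b1, -, -, b4⟩ := hB 3 (by norm_num)
  norm_num at b1 b4
  set S0 : Finset V := (sphere G x 3 \ B).toFinset with hS0
  set M := 3 * K ^ 2 * d ^ 2 with hM
  set f : V → Finset V → ℝ := fun v A => if v ∉ bootIter G (A : Set V) 2 then (1 : ℝ) else 0 with hf
  obtain ⟨col, hc1, hc2⟩ := greedy (fun y z : V => z ∈ ball G y 5)
    (fun a b h => by
      have h' : G.edist a b ≤ (5 : ℕ) := h
      show G.edist b a ≤ (5 : ℕ)
      rw [SimpleGraph.edist_comm]; exact h')
    (fun a => by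
      show G.edist a a ≤ (5 : ℕ)
      simp) M S0 (fun y hy => by
      have hy' : y ∈ sphere G x 3 \ B := by rw [hS0, Set.mem_toFinset] at hy; exact hy
      have := b4 y hy'.1 hy'.2
      rw [hx] at this
      refine le_trans ?_ this
      rw [← Set.ncard_coe_finset]
      refine Set.ncard_le_ncard ?_ (Set.toFinite _)
      intro z hz
      rw [Finset.mem_coe, Finset.mem_filter, hS0, Set.mem_toFinset] at hz
      exact ⟨hz.2, hz.1⟩)
  set C : ℕ → Finset V := fun i => S0.filter (fun v => col v = i) with hC
  have hd0 : (0 : ℝ) < d := by exact_mod_cast (by omega : 0 < d)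
  have hdpos : 0 < d := by omega
  have hMpos : 0 < M := by rw [hM]; positivity
  -- per class bound
  have hclass : ∀ i, ES p Finset.univ (fun A => if α * (C i).card + β * d ≤ ∑ v ∈ C i, f v A then (1 : ℝ) else 0) ≤
      Real.exp (-((K + 2) * d)) := by
    intro i
    refine (chernoff h0 h1 (C i) f (fun v => (ball G v 2).toFinset) ?_ ?_ ?_ (θ * α * Real.exp (-θ)) θ
      (α * (C i).card + β * d) (fun v _ => hη v) hθ0).trans ?_
    · intro v A
      by_cases h : v ∉ bootIter G (A : Set V) 2
      · right; exact if_pos h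
      · left; exact if_neg h
    · intro v _ A
      have := bootIter_local (G := G) 2 v (A : Set V) ((A ∩ (ball G v 2).toFinset : Finset V) : Set V) (by
        rw [Finset.coe_inter, Set.coe_toFinset, Set.inter_assoc, Set.inter_self])
      simp only [hf, this]
    · intro v hv w hw hvw
      rw [Finset.disjoint_left]
      intro z hz1 hz2
      rw [Set.mem_toFinset] at hz1 hz2
      rw [hC, Finset.mem_filter] at hv hw
      refine hc2 v hv.1 w hw.1 hvw ?_ (hv.2.trans hw.2.symm)
      have e1 : G.edist v z ≤ (2 : ℕ) := hz1
      have e2 : G.edist w z ≤ (2 : ℕ) := hz2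
      show G.edist v w ≤ (5 : ℕ)
      calc G.edist v w ≤ G.edist v z + G.edist z w := SimpleGraph.edist_triangle
        _ ≤ (2 : ℕ) + (2 : ℕ) := by rw [SimpleGraph.edist_comm (u := z)]; gcongr
        _ ≤ (5 : ℕ) := by norm_num
    · apply Real.exp_le_exp.2
      have e1 : Real.exp θ * (θ * α * Real.exp (-θ)) = θ * α := by
        rw [Real.exp_neg]; field_simp
      have e2 : θ * β = K + 2 := by rw [hθ]; field_simp
      rw [e1]
      apply le_of_eq
      rw [← e2]; ring
  -- pointwise bound
  have hpt : ∀ A : Finset V, (if x ∉ bootIter G (A : Set V) 5 then (1 : ℝ) else 0) ≤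
      ∑ i ∈ Finset.range M, (if α * (C i).card + β * d ≤ ∑ v ∈ C i, f v A then (1 : ℝ) else 0) := by
    intro A
    by_cases h : x ∉ bootIter G (A : Set V) 5
    · rw [if_pos h]
      have hmany := many_uninf K hP1 hP2 x B b1 (by omega) (by omega) (A : Set V) h
      rw [hx] at hmany
      have hsum : ∑ v ∈ S0, f v A = (((sphere G x 3 \ B).toFinset).filter (fun v => v ∉ bootIter G (A : Set V) 2)).card := by
        rw [Finset.card_filter]
        push_cast
        rfl
      have hmany' : (d : ℝ) ^ 3 ≤ 384 * K ^ 2 * ∑ v ∈ S0, f v A := by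
        rw [hsum]; exact_mod_cast hmany
      have hex : ∃ i ∈ Finset.range M, α * (C i).card + β * d ≤ ∑ v ∈ C i, f v A := by
        by_contra hno
        push Not at hno
        have s1 : ∑ i ∈ Finset.range M, ∑ v ∈ C i, f v A < ∑ i ∈ Finset.range M, (α * (C i).card + β * d) :=
          Finset.sum_lt_sum_of_nonempty ⟨0, Finset.mem_range.2 hMpos⟩ hno
        have hmaps : ∀ v ∈ S0, col v ∈ Finset.range M := fun v hv => Finset.mem_range.2 (hc1 v hv)
        have s2 : ∑ i ∈ Finset.range M, ∑ v ∈ C i, f v A = ∑ v ∈ S0, f v A :=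
          Finset.sum_fiberwise_of_maps_to hmaps _
        have s3 : ∑ i ∈ Finset.range M, ((C i).card : ℝ) = S0.card := by
          rw [Finset.card_eq_sum_card_fiberwise hmaps]
          push_cast; rfl
        rw [Finset.sum_add_distrib, ← Finset.mul_sum, s2, s3, Finset.sum_const, Finset.card_range,
          nsmul_eq_mul] at s1
        have s4 : (S0.card : ℝ) ≤ 4 * d ^ 3 := by
          have t1 : S0.card ≤ (sphere G x 3).ncard := by
            rw [← Set.ncard_coe_finset]
            refine Set.ncard_le_ncard ?_ (Set.toFinite _)
            intro z hz
            rw [Finset.mem_coe, hS0, Set.mem_toFinset] at hz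
            exact hz.1
          have t2 := sphere3_card K hP1 x (by omega)
          rw [hx] at t2
          exact_mod_cast t1.trans t2
        have s5 : (M : ℝ) = 3 * K ^ 2 * d ^ 2 := by rw [hM]; push_cast; ring
        have s6 : c * d ^ 3 ≤ ∑ v ∈ S0, f v A := by
          rw [hc, div_mul_eq_mul_div, div_le_iff₀ (by positivity)]
          linarith
        have s7 : (M : ℝ) * (β * d) = c / 2 * d ^ 3 := by
          rw [s5, hβ]; field_simp; norm_num
        have s8 : α * S0.card ≤ c / 2 * d ^ 3 := by
          calc α * S0.card ≤ α * (4 * d ^ 3) := by gcongr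
            _ = _ := by rw [hα]; ring
        linarith
      obtain ⟨i, hi, hi2⟩ := hex
      refine le_trans (le_of_eq (if_pos hi2).symm)
        (Finset.single_le_sum (f := fun i => (if α * (C i).card + β * d ≤ ∑ v ∈ C i, f v A then (1 : ℝ) else 0))
          (fun j _ => ?_) hi)
      show (0 : ℝ) ≤ if _ then _ else _
      split_ifs <;> norm_num
    · rw [if_neg h]
      refine Finset.sum_nonneg fun j _ => ?_
      split_ifs <;> norm_num
  calc _ ≤ ES p Finset.univ (fun A => ∑ i ∈ Finset.range M,
        (if α * (C i).card + β * d ≤ ∑ v ∈ C i, f v A then (1 : ℝ) else 0)) := ES_mono h0 h1 fun A _ => hpt A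
    _ = ∑ i ∈ Finset.range M, ES p Finset.univ (fun A =>
        (if α * (C i).card + β * d ≤ ∑ v ∈ C i, f v A then (1 : ℝ) else 0)) := ES_sum _ _ _ _
    _ ≤ ∑ i ∈ Finset.range M, Real.exp (-((K + 2) * d)) := Finset.sum_le_sum fun i _ => hclass i
    _ = M * Real.exp (-((K + 2) * d)) := by rw [Finset.sum_const, Finset.card_range, nsmul_eq_mul]
    _ ≤ Real.exp d * Real.exp (-((K + 2) * d)) := by
        gcongr
        have t1 := Real.pow_div_factorial_le_exp (d : ℝ) hd0.le 3
        have t2 : (18 * K ^ 2 : ℝ) ≤ d := by exact_mod_cast hd3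
        refine le_trans ?_ t1
        rw [hM]
        norm_num [Nat.factorial]
        rw [le_div_iff₀ (by norm_num)]
        calc (3 * K ^ 2 * d ^ 2 * 6 : ℝ) = 18 * K ^ 2 * d ^ 2 := by ring
          _ ≤ d * d ^ 2 := by gcongr
          _ = _ := by ring
    _ = _ := by rw [← Real.exp_add]; congr 1; ring

lemma minDeg_le {V : Type} (G : SimpleGraph V) (x : V) : minDeg G ≤ deg G x :=
  Nat.sInf_le ⟨x, rfl⟩

lemma le_maxDeg {V : Type} [Finite V] (G : SimpleGraph V) (x : V) : deg G x ≤ maxDeg G :=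
  le_csSup (Set.finite_range _).bddAbove ⟨x, rfl⟩

lemma InH_props {K : ℕ} {V : Type} [Finite V] {G : SimpleGraph V} (h : InH K G) (hd : 1 ≤ minDeg G) :
    1 ≤ K ∧ P1 K G ∧ P2 K G ∧ P3 K G ∧ P5 K G := by
  have hne : Nonempty V := by
    by_contra hne
    rw [not_nonempty_iff] at hne
    have : minDeg G = 0 := by unfold minDeg; simp [hne]
    omega
  obtain ⟨x⟩ := hne
  have hx := (hd.trans (minDeg_le G x))
  obtain ⟨y, hy⟩ : ∃ y, G.Adj x y := by
    have : (G.neighborSet x).Nonempty := by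
      rw [← Set.ncard_pos]; exact hx
    exact this
  have hcard : Nat.card V ≠ 1 := by
    intro h1
    have : Subsingleton V := (Nat.card_eq_one_iff_unique.1 h1).1
    exact hy.ne (Subsingleton.elim _ _)
  obtain ⟨n, hn⟩ := h
  have hP : P1 K G ∧ P2 K G ∧ P3 K G ∧ P5 K G := by
    cases n with
    | zero => exact absurd hn hcard
    | succ n =>
      rcases hn with h | h
      · exact absurd h hcard
      · exact ⟨h.1, h.2.1, h.2.2.1, h.2.2.2.2⟩
  refine ⟨?_, hP⟩
  have h2 := hP.2.1 x 1 le_rfl y (mem_sphere_one.2 hy)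
  have h3 : 0 < (G.neighborSet y ∩ ball G x 1).ncard := by
    rw [Set.ncard_pos]
    refine ⟨x, hy.symm, ?_⟩
    show G.edist x x ≤ (1 : ℕ)
    simp
  omega

lemma Phi_bounds {V : Type} [Finite V] (G : SimpleGraph V) {p : ℝ} (h0 : 0 ≤ p) (h1 : p ≤ 1) (b : ℝ)
    (hb : ∀ [Fintype V] [DecidableEq V] (x : V), open Classical in
      ES p Finset.univ (fun A : Finset V => if x ∉ bootIter G (A : Set V) 5 then (1 : ℝ) else 0) ≤ b) :
    1 - Nat.card V * b ≤ Phi p G ∧ Phi p G ≤ 1 := by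
  classical
  have := Fintype.ofFinite V
  have e : Phi p G = ES p Finset.univ (fun A : Finset V => if Percolates G (A : Set V) then (1 : ℝ) else 0) :=
    prob_eq p (fun A0 => Percolates G A0)
  rw [e]
  constructor
  · have k1 : ES p Finset.univ (fun A : Finset V => (1 : ℝ) -
        ∑ x : V, if x ∉ bootIter G (A : Set V) 5 then (1 : ℝ) else 0) ≤
        ES p Finset.univ (fun A : Finset V => if Percolates G (A : Set V) then (1 : ℝ) else 0) := by
      refine ES_mono h0 h1 fun A _ => ?_
      have hnn : ∀ y : V, (0 : ℝ) ≤ if y ∉ bootIter G (A : Set V) 5 then (1 : ℝ) else 0 := by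
        intro y; split_ifs <;> norm_num
      by_cases h : Percolates G (A : Set V)
      · rw [if_pos h]
        have := Finset.sum_nonneg (s := Finset.univ) fun y _ => hnn y
        linarith
      · rw [if_neg h]
        obtain ⟨x, hx⟩ : ∃ x, x ∉ bootIter G (A : Set V) 5 := by
          by_contra hno
          push Not at hno
          exact h (Set.eq_univ_of_forall fun x => Set.mem_iUnion.2 ⟨5, hno x⟩)
        have := Finset.single_le_sum (fun y _ => hnn y) (Finset.mem_univ x)
        rw [if_pos hx] at this
        linarith
    refine le_trans ?_ k1
    rw [ES_sub, ES_const, ES_sum]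
    have k2 : ∑ x : V, ES p Finset.univ (fun A : Finset V => if x ∉ bootIter G (A : Set V) 5 then (1 : ℝ) else 0) ≤
        ∑ x : V, b := Finset.sum_le_sum fun x _ => hb x
    rw [Finset.sum_const, nsmul_eq_mul, Finset.card_univ, ← Nat.card_eq_fintype_card] at k2
    linarith
  · refine le_trans (ES_mono h0 h1 (g := fun _ => 1) fun A _ => ?_) (ES_const _ _ _).le
    split_ifs <;> norm_num

/-- finer 1-statement, recovering the Balogh–Bollobás–Morris bound. -/
theorem statement14 (K : ℕ) (lam : ℝ) (hlam : 1 / 2 < lam)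
    (V : ℕ → Type) (hfin : ∀ n, Finite (V n))
    (G : ∀ n, SimpleGraph (V n))
    (hH : ∀ n, InH K (G n))
    (hδ : Tendsto (fun n => minDeg (G n)) atTop atTop)
    (p : ℕ → ℝ) (hp : ∀ n, p n ∈ Set.Icc (0 : ℝ) 1)
    (hlow : ∀ n,
      1 / 2 - (1 / 2) * Real.sqrt (Real.log (maxDeg (G n)) / (maxDeg (G n)))
          + lam * Real.log (Real.log (maxDeg (G n))) /
            Real.sqrt ((maxDeg (G n) : ℝ) * Real.log (maxDeg (G n)))
        ≤ p n) :
    Tendsto (fun n => Phi (p n) (G n)) atTop (nhds 1) := by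
  classical
  have hdlarge : ∀ m : ℕ, ∀ᶠ n in atTop, m ≤ minDeg (G n) := fun m => hδ.eventually (eventually_ge_atTop m)
  have hK : 1 ≤ K := by
    obtain ⟨n, hn⟩ := (hdlarge 1).exists
    have := hfin n
    exact (InH_props (hH n) hn).1
  obtain ⟨η, hη, hB⟩ := stepB K hK
  obtain ⟨D1, hD1⟩ := eventually_atTop.1 hB
  obtain ⟨D2, hD2⟩ := eventually_atTop.1 (stepA K η hη)
  obtain ⟨D3, hD3⟩ := eventually_atTop.1 (eps_compare lam hlam)
  have hmain : ∀ᶠ n in atTop, 1 - Real.exp (-(minDeg (G n) : ℝ)) ≤ Phi (p n) (G n) ∧ Phi (p n) (G n) ≤ 1 := by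
    filter_upwards [hdlarge 1, hdlarge D1, hdlarge D2, hdlarge D3] with n h1 h2 h3 h4
    have := hfin n
    obtain ⟨-, hP1, hP2, hP3, hP5⟩ := InH_props (hH n) h1
    have hb := Phi_bounds (G n) (hp n).1 (hp n).2 (Real.exp (-((K + 1) * minDeg (G n)))) (by
      intro _ _ x
      have hA : ∀ v : V n, ES (p n) Finset.univ (fun A : Finset (V n) =>
          if v ∉ bootIter (G n) (A : Set (V n)) 2 then (1 : ℝ) else 0) ≤ η := by
        intro v
        have hv := minDeg_le (G n) v
        exact hD2 (deg (G n) v) (h3.trans hv) (V n) (G n) hP1 hP2 hP3 v rfl (p n)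
          ((hD3 (deg (G n) v) (h4.trans hv) (maxDeg (G n)) (le_maxDeg (G n) v)).trans (hlow n)) (hp n).2
      have hx := minDeg_le (G n) x
      refine (hD1 (deg (G n) x) (h2.trans hx) (V n) (G n) hP1 hP2 hP3 x rfl (p n) (hp n).1 (hp n).2 hA).trans ?_
      apply Real.exp_le_exp.2
      have : (minDeg (G n) : ℝ) ≤ deg (G n) x := by exact_mod_cast hx
      have hK0 : (0 : ℝ) ≤ K + 1 := by positivity
      nlinarith)
    refine ⟨le_trans ?_ hb.1, hb.2⟩
    have hc : (Nat.card (V n) : ℝ) * Real.exp (-((K + 1) * minDeg (G n))) ≤ Real.exp (-(minDeg (G n) : ℝ)) := by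
      calc (Nat.card (V n) : ℝ) * Real.exp (-((K + 1) * minDeg (G n))) ≤
          Real.exp (K * minDeg (G n)) * Real.exp (-((K + 1) * minDeg (G n))) :=
            mul_le_mul_of_nonneg_right hP5 (Real.exp_pos _).le
        _ = _ := by rw [← Real.exp_add]; congr 1; ring
    linarith
  have hlim : Tendsto (fun n => 1 - Real.exp (-(minDeg (G n) : ℝ))) atTop (nhds 1) := by
    have hd : Tendsto (fun n => (minDeg (G n) : ℝ)) atTop atTop := tendsto_natCast_atTop_atTop.comp hδ
    have := (Real.tendsto_exp_neg_atTop_nhds_zero.comp hd).const_sub 1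
    simpa using this
  exact tendsto_of_tendsto_of_tendsto_of_le_of_le' hlim tendsto_const_nhds
    (hmain.mono fun n h => h.1) (hmain.mono fun n h => h.2)

end MBP
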